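/- arXiv:2403.07253 — 5 statements merged into one kernel-verified Lean document; each statement's English description precedes it below -/
import Mathlib

section
/- Let n = 1, let 1/2 ≤ α ≤ 1 and let r > 0. For every s < (1−α)/2 + min( (2α−1)/4 , r(2α−1)/(2r + α) ) and every C > 0 there exist a Schwartz function f : ℝ → ℂ, a sequence (t_k) ∈ ℓ^{r,∞} with ⟨(t_k)⟩ ≤ 1 and t_k → 0, and an α-dimensional Borel measure μ on ℝ with constant C_μ ≤ 1, such that ∫_{B(0,1)} sup_k |e^{it_kΔ}f(x)|² dμ(x) > C ‖f‖²_{H^s}. -/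
open MeasureTheory Filter FourierTransform
open scoped ENNReal

noncomputable section

/-- The one-dimensional Schrödinger evolution `e^{itΔ}f(x) = ∫ f̂(ξ) e^{2πi(xξ + tξ²)} dξ`. -/
def schrodingerEvolution1D (f : ℝ → ℂ) (t x : ℝ) : ℂ :=
  ∫ ξ : ℝ, (𝓕 f ξ) * Complex.exp (2 * Real.pi * Complex.I * ((x * ξ + t * ξ ^ 2 : ℝ) : ℂ))

/-- The squared Sobolev norm `‖f‖_{H^s}² = ∫ (1+|ξ|²)^s |f̂(ξ)|² dξ` on `ℝ`. -/
def sobolevNormSq1D (s : ℝ) (f : ℝ → ℂ) : ℝ :=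
  ∫ ξ : ℝ, (1 + ‖ξ‖ ^ 2) ^ s * ‖𝓕 f ξ‖ ^ 2

/-- `μ` is an `α`-dimensional measure on `ℝ` with constant `C`: `μ(B(x,ρ)) ≤ C ρ^α`. -/
def IsAlphaDimensional1D (α C : ℝ) (μ : Measure ℝ) : Prop :=
  ∀ (x ρ : ℝ), 0 < ρ → μ (Metric.ball x ρ) ≤ ENNReal.ofReal (C * ρ ^ α)

/-- The sequence `t` belongs to `ℓ^{r,∞}` with constant at most `c`:
`sup_{δ>0} δ^r #{k : |t_k| ≥ δ} ≤ c`. -/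
def MemLorentz (r : ℝ) (t : ℕ → ℝ) (c : ℝ) : Prop :=
  ∀ δ : ℝ, 0 < δ →
    ENNReal.ofReal (δ ^ r) * ({k : ℕ | δ ≤ |t k|}.encard : ℝ≥0∞) ≤ ENNReal.ofReal c

/-- The quantity `∫_{B(0,1)} sup_k |e^{it_kΔ}f(x)|² dμ(x)` on `ℝ`. -/
def maximalIntegral1D (μ : Measure ℝ) (t : ℕ → ℝ) (f : ℝ → ℂ) : ℝ≥0∞ :=
  ∫⁻ x in Metric.ball (0 : ℝ) 1,
    ⨆ k : ℕ, ENNReal.ofReal (‖schrodingerEvolution1D f (t k) x‖ ^ 2) ∂μ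

/-- A bump function of width `φ.rOut` around the frequency `N` evolves into a wave packet that
stays large near `x = -2tN` as long as `|t|` is at most a multiple of `φ.rOut ^ (-2)`. -/
lemma half_integral_le_norm_schrodingerEvolution1D {N : ℝ} (φ : ContDiffBump N) {f : ℝ → ℂ}
    (hf : ∀ ξ, 𝓕 f ξ = (φ ξ : ℂ)) {t x : ℝ} (hx : |x + 2 * t * N| * φ.rOut ≤ 1 / 20)
    (ht : |t| * φ.rOut ^ 2 ≤ 1 / 20) :
    (∫ ξ, φ ξ) / 2 ≤ ‖schrodingerEvolution1D f t x‖ := by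
  set ψ : ℝ → ℝ := fun ξ => 2 * Real.pi * ((ξ - N) * (x + 2 * t * N) + t * (ξ - N) ^ 2)
  have hφ : Integrable (fun ξ => φ ξ) := φ.integrable
  have hint : Integrable fun ξ : ℝ => (φ ξ : ℂ) * Complex.exp (ψ ξ * Complex.I) := by
    refine hφ.ofReal.mul_bdd (c := 1) (by fun_prop) (.of_forall fun ξ => ?_)
    rw [Complex.norm_exp_ofReal_mul_I]
  have hfac : schrodingerEvolution1D f t x =
      Complex.exp ((2 * Real.pi * (x * N + t * N ^ 2) : ℝ) * Complex.I) *
        ∫ ξ : ℝ, (φ ξ : ℂ) * Complex.exp (ψ ξ * Complex.I) := by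
    rw [schrodingerEvolution1D, ← integral_const_mul]
    congr 1 with ξ
    rw [hf, mul_left_comm, ← Complex.exp_add]
    congr 2
    simp only [ψ]
    push_cast
    ring
  rw [hfac, norm_mul, Complex.norm_exp_ofReal_mul_I, one_mul]
  refine le_trans ?_ (Complex.re_le_norm _)
  have hre : (∫ ξ : ℝ, (φ ξ : ℂ) * Complex.exp (ψ ξ * Complex.I)).re =
      ∫ ξ : ℝ, φ ξ * Real.cos (ψ ξ) := by
    have := integral_re hint
    simp only [RCLike.re_to_complex] at this
    rw [← this]
    congr 1 with ξ
    rw [Complex.re_ofReal_mul, Complex.exp_ofReal_mul_I_re]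
  have hcos : Integrable fun ξ : ℝ => φ ξ * Real.cos (ψ ξ) := by
    refine hφ.mul_bdd (c := 1) (by fun_prop) (.of_forall fun ξ => ?_)
    exact Real.abs_cos_le_one _
  rw [hre, ← integral_div]
  refine integral_mono (hφ.div_const 2) hcos fun ξ => ?_
  by_cases hξ : φ.rOut ≤ dist ξ N
  · simp [φ.zero_of_le_dist hξ]
  · rw [Real.dist_eq, not_le] at hξ
    have hlin : |(ξ - N) * (x + 2 * t * N) + t * (ξ - N) ^ 2| ≤ 1 / 10 := by
      refine (abs_add_le _ _).trans ?_
      rw [abs_mul, abs_mul, abs_pow]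
      have h₁ : |ξ - N| * |x + 2 * t * N| ≤ |x + 2 * t * N| * φ.rOut := by
        rw [mul_comm]; gcongr
      have h₂ : |t| * |ξ - N| ^ 2 ≤ |t| * φ.rOut ^ 2 := by gcongr
      linarith
    have hψ : |ψ ξ| ≤ 1 := by
      simp only [ψ]
      rw [abs_mul, abs_of_pos (by positivity)]
      nlinarith [Real.pi_pos, Real.pi_lt_four, Real.pi_lt_d2,
        mul_le_mul_of_nonneg_left hlin Real.two_pi_pos.le]
    have hsq : ψ ξ ^ 2 ≤ 1 := (sq_le_one_iff_abs_le_one _).2 hψ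
    have hge : 1 / 2 ≤ Real.cos (ψ ξ) := by
      linarith [Real.one_sub_sq_div_two_le_cos (x := ψ ξ)]
    have := mul_le_mul_of_nonneg_left hge (φ.nonneg' ξ)
    dsimp only
    linarith

lemma sobolevNormSq1D_le {N s : ℝ} (hN : 1 ≤ N) (hs : 0 ≤ s) {s₀ : ℝ} (hs₀ : s₀ ≤ s)
    (φ : ContDiffBump N) (hφN : φ.rOut ≤ N) {f : ℝ → ℂ} (hf : ∀ ξ, 𝓕 f ξ = (φ ξ : ℂ)) :
    sobolevNormSq1D s₀ f ≤ (5 * N ^ 2) ^ s * ∫ ξ, φ ξ := by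
  rw [sobolevNormSq1D, ← integral_const_mul]
  refine integral_mono_of_nonneg (.of_forall fun ξ => by positivity) (φ.integrable.const_mul _)
    (.of_forall fun ξ => ?_)
  dsimp only
  rw [hf, Complex.norm_real, Real.norm_of_nonneg (φ.nonneg' ξ)]
  by_cases hξ : φ.rOut ≤ dist ξ N
  · simp [φ.zero_of_le_dist hξ]
  · rw [Real.dist_eq, not_le, abs_lt] at hξ
    have hbase : 1 + ‖ξ‖ ^ 2 ≤ 5 * N ^ 2 := by
      rw [Real.norm_eq_abs, sq_abs]
      nlinarith
    have hone : 1 ≤ 1 + ‖ξ‖ ^ 2 := by nlinarith [sq_nonneg ‖ξ‖]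
    have hpow : (1 + ‖ξ‖ ^ 2) ^ s₀ ≤ (5 * N ^ 2) ^ s :=
      (Real.rpow_le_rpow_of_exponent_le hone hs₀).trans
        (Real.rpow_le_rpow (by positivity) hbase hs)
    have hsq : φ ξ ^ 2 ≤ φ ξ := by nlinarith [φ.nonneg' ξ, φ.le_one (x := ξ)]
    gcongr

lemma exists_schwartzMap_fourier_eq {N : ℝ} (φ : ContDiffBump N) :
    ∃ f : SchwartzMap ℝ ℂ, ∀ ξ, 𝓕 (f : ℝ → ℂ) ξ = (φ ξ : ℂ) := by
  have hsupp : HasCompactSupport fun ξ => (φ ξ : ℂ) :=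
    φ.hasCompactSupport.comp_left Complex.ofReal_zero
  have hsmooth : ContDiff ℝ ((⊤ : ℕ∞) : WithTop ℕ∞) fun ξ => (φ ξ : ℂ) :=
    Complex.ofRealCLM.contDiff.comp φ.contDiff
  refine ⟨𝓕⁻ (hsupp.toSchwartzMap hsmooth), fun ξ => ?_⟩
  rw [← SchwartzMap.fourier_coe, FourierTransform.fourier_fourierInv_eq]
  rfl

/-- `b` times Lebesgue measure on `M` intervals of radius `w` centred at `0, -d, …, -(M - 1)d`,
counted with multiplicity. -/
def combMeasure (b w d : ℝ) (M : ℕ) : Measure ℝ :=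
  ∑ k ∈ Finset.range M, ENNReal.ofReal b • volume.restrict (Metric.ball (-(k * d)) w)

lemma card_le_of_forall_sub_le {S : Finset ℕ} {D : ℝ} (hD : 0 ≤ D)
    (hS : ∀ k ∈ S, ∀ l ∈ S, (l : ℝ) - k ≤ D) : (S.card : ℝ) ≤ D + 1 := by
  rcases S.eq_empty_or_nonempty with rfl | hne
  · simp only [Finset.card_empty, Nat.cast_zero]; linarith
  · have hsub : S ⊆ Finset.Icc (S.min' hne) (S.max' hne) := fun k hk =>
      Finset.mem_Icc.2 ⟨S.min'_le k hk, S.le_max' k hk⟩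
    have hcard := Finset.card_le_card hsub
    rw [Nat.card_Icc] at hcard
    have hle : S.card + S.min' hne ≤ S.max' hne + 1 := by
      have := S.min'_le_max' hne
      omega
    have := hS _ (S.min'_mem hne) _ (S.max'_mem hne)
    have hle' : (S.card : ℝ) + (S.min' hne : ℕ) ≤ (S.max' hne : ℕ) + 1 := by exact_mod_cast hle
    linarith

lemma combMeasure_ball_le {b w d ρ : ℝ} (hb : 0 ≤ b) (hw : 0 < w) (hd : 0 < d) (hρ : 0 < ρ)
    (M : ℕ) (x : ℝ) :
    ∃ m : ℝ, 0 ≤ m ∧ m ≤ M ∧ m ≤ 2 * (ρ + w) / d + 1 ∧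
      combMeasure b w d M (Metric.ball x ρ) ≤ ENNReal.ofReal (m * (b * (2 * min ρ w))) := by
  classical
  set S := (Finset.range M).filter fun k : ℕ =>
    (Metric.ball x ρ ∩ Metric.ball (-(k * d)) w).Nonempty
  refine ⟨S.card, by positivity, ?_, ?_, ?_⟩
  · exact_mod_cast (Finset.card_filter_le _ _).trans (Finset.card_range M).le
  · refine card_le_of_forall_sub_le (by positivity) fun k hk l hl => ?_
    obtain ⟨y, hy₁, hy₂⟩ := (Finset.mem_filter.1 hk).2
    obtain ⟨z, hz₁, hz₂⟩ := (Finset.mem_filter.1 hl).2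
    rw [Metric.mem_ball, Real.dist_eq, abs_lt] at hy₁ hy₂ hz₁ hz₂
    rw [le_div_iff₀ hd]
    linarith
  · rw [combMeasure, Measure.finsetSum_apply]
    have hterm : ∀ k ∈ S, (ENNReal.ofReal b • volume.restrict (Metric.ball (-(k * d)) w))
        (Metric.ball x ρ) ≤ ENNReal.ofReal (b * (2 * min ρ w)) := by
      intro k _
      rw [Measure.smul_apply, smul_eq_mul, Measure.restrict_apply Metric.isOpen_ball.measurableSet,
        ENNReal.ofReal_mul hb]
      gcongr
      rcases min_choice ρ w with h | h <;> rw [h]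
      · exact (measure_mono Set.inter_subset_left).trans (Real.volume_ball x ρ).le
      · exact (measure_mono Set.inter_subset_right).trans (Real.volume_ball _ w).le
    calc ∑ k ∈ Finset.range M, (ENNReal.ofReal b • volume.restrict (Metric.ball (-(k * d)) w))
          (Metric.ball x ρ)
        = ∑ k ∈ S, (ENNReal.ofReal b • volume.restrict (Metric.ball (-(k * d)) w))
          (Metric.ball x ρ) := by
          refine (Finset.sum_filter_of_ne fun k _ hk => ?_).symm
          by_contra hempty
          rw [Set.not_nonempty_iff_eq_empty] at hempty
          apply hk
          rw [Measure.smul_apply, Measure.restrict_apply Metric.isOpen_ball.measurableSet, hempty,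
            measure_empty, smul_zero]
      _ ≤ ∑ _k ∈ S, ENNReal.ofReal (b * (2 * min ρ w)) := Finset.sum_le_sum hterm
      _ = ENNReal.ofReal (S.card * (b * (2 * min ρ w))) := by
          rw [Finset.sum_const, nsmul_eq_mul, ENNReal.ofReal_mul S.card.cast_nonneg,
            ENNReal.ofReal_natCast]

lemma isAlphaDimensional1D_combMeasure {α w d : ℝ} (hα0 : 0 ≤ α) (hα : α ≤ 1) (hw : 0 < w)
    (hwd : 2 * w ≤ d) {M : ℕ} (hM : 0 < M) (hMw : M * w ^ α ≤ (M * d) ^ α) :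
    IsAlphaDimensional1D α 1 (combMeasure (w ^ (α - 1) / 10) w d M) := by
  intro x ρ hρ
  have hd : 0 < d := by linarith
  have hM' : (0 : ℝ) < M := by exact_mod_cast hM
  obtain ⟨m, hm0, hmM, hmd, hle⟩ :=
    combMeasure_ball_le (b := w ^ (α - 1) / 10) (by positivity) hw hd hρ M x
  refine hle.trans (ENNReal.ofReal_le_ofReal ?_)
  rw [one_mul]
  have hρα : 0 < ρ ^ α := by positivity
  have hsplit : ∀ y : ℝ, 0 < y → y ^ (α - 1) * y = y ^ α := fun y hy => by
    rw [← Real.rpow_add_one hy.ne', sub_add_cancel]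
  have hanti : ∀ y : ℝ, ρ ≤ y → y ^ (α - 1) * ρ ≤ ρ ^ α := fun y hy => by
    rw [← hsplit ρ hρ]
    exact mul_le_mul_of_nonneg_right
      (Real.rpow_le_rpow_of_nonpos hρ hy (by linarith)) hρ.le
  rcases le_total ρ w with hρw | hwρ
  · rw [min_eq_left hρw]
    have hm3 : m ≤ 3 := by
      have : 2 * (ρ + w) / d ≤ 2 := by
        rw [div_le_iff₀ hd]; linarith
      linarith
    have h0 : 0 ≤ w ^ (α - 1) * ρ := by positivity
    nlinarith [hanti w hρw]
  · rw [min_eq_right hwρ]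
    have hwα : w ^ α ≤ ρ ^ α := Real.rpow_le_rpow hw.le hwρ hα0
    have hgoal : m * w ^ α ≤ 5 * ρ ^ α := by
      rcases le_total ρ (M * d) with hρL | hLρ
      · have hm4 : m ≤ 4 * ρ / d + 1 := by
          have : 2 * (ρ + w) / d ≤ 4 * ρ / d :=
            div_le_div_of_nonneg_right (by linarith) hd.le
          linarith
        have hpart : ρ / d * w ^ α ≤ ρ ^ α := calc
          ρ / d * w ^ α = ρ / (M * d) * (M * w ^ α) := by field_simp
          _ ≤ ρ / (M * d) * (M * d) ^ α := by gcongr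
          _ = (M * d) ^ (α - 1) * ρ := by
            rw [← hsplit (M * d) (by positivity)]; field_simp
          _ ≤ ρ ^ α := hanti _ hρL
        calc m * w ^ α ≤ (4 * ρ / d + 1) * w ^ α := by gcongr
          _ = 4 * (ρ / d * w ^ α) + w ^ α := by ring
          _ ≤ 5 * ρ ^ α := by linarith
      · calc m * w ^ α ≤ M * w ^ α := by gcongr
          _ ≤ (M * d) ^ α := hMw
          _ ≤ ρ ^ α := Real.rpow_le_rpow (by positivity) hLρ hα0
          _ ≤ 5 * ρ ^ α := by linarith
    calc m * (w ^ (α - 1) / 10 * (2 * w)) = m * (w ^ (α - 1) * w) / 5 := by ring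
      _ = m * w ^ α / 5 := by rw [hsplit w hw]
      _ ≤ ρ ^ α := by linarith

/-- The first `M` terms of the arithmetic progression `0, τ, 2τ, …`, followed by zeros. -/
def truncatedProgression (τ : ℝ) (M k : ℕ) : ℝ := if k < M then k * τ else 0

lemma tendsto_truncatedProgression (τ : ℝ) (M : ℕ) :
    Tendsto (truncatedProgression τ M) atTop (nhds 0) := by
  refine tendsto_const_nhds.congr' ?_
  filter_upwards [eventually_ge_atTop M] with k hk
  rw [truncatedProgression, if_neg (not_lt.2 hk)]

lemma memLorentz_truncatedProgression {r τ : ℝ} (hr : 0 ≤ r) (hτ : 0 ≤ τ) {M : ℕ}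
    (h : M * (M * τ) ^ r ≤ 1) : MemLorentz r (truncatedProgression τ M) 1 := by
  intro δ hδ
  have hlt : ∀ k, δ ≤ |truncatedProgression τ M k| → k < M ∧ δ ≤ M * τ := by
    intro k hk
    rw [truncatedProgression] at hk
    split_ifs at hk with hkM
    · refine ⟨hkM, hk.trans ?_⟩
      rw [abs_of_nonneg (by positivity)]
      gcongr
    · simp only [abs_zero] at hk; linarith
  rcases Set.eq_empty_or_nonempty {k : ℕ | δ ≤ |truncatedProgression τ M k|} with hemp | ⟨k, hk⟩
  · simp [hemp]
  · have hδM := (hlt k hk).2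
    have hsub : {k : ℕ | δ ≤ |truncatedProgression τ M k|} ⊆ (Finset.range M : Set ℕ) :=
      fun k hk => by simpa using (hlt k hk).1
    have hcard : ({k : ℕ | δ ≤ |truncatedProgression τ M k|}.encard : ℝ≥0∞) ≤ (M : ℝ≥0∞) := by
      have := Set.encard_le_encard hsub
      rw [Set.encard_coe_eq_coe_finsetCard, Finset.card_range] at this
      exact_mod_cast this
    calc ENNReal.ofReal (δ ^ r) * ({k : ℕ | δ ≤ |truncatedProgression τ M k|}.encard : ℝ≥0∞)
        ≤ ENNReal.ofReal ((M * τ) ^ r) * (M : ℝ≥0∞) := by gcongr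
      _ = ENNReal.ofReal (M * (M * τ) ^ r) := by
        rw [mul_comm, ENNReal.ofReal_mul (by positivity), ENNReal.ofReal_natCast]
      _ ≤ ENNReal.ofReal 1 := ENNReal.ofReal_le_ofReal h

/-- Lower bound for the maximal integral of a frequency-localized wave packet against the comb
measure along which its centre travels. -/
lemma ofReal_le_maximalIntegral1D {N b w τ : ℝ} (hN : 0 ≤ N) (hb : 0 ≤ b) (hτ : 0 ≤ τ) {M : ℕ}
    (φ : ContDiffBump N) {f : ℝ → ℂ} (hf : ∀ ξ, 𝓕 f ξ = (φ ξ : ℂ)) (hw : w * φ.rOut ≤ 1 / 20)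
    (hτM : M * τ * φ.rOut ^ 2 ≤ 1 / 20) (hball : M * (2 * N * τ) + w ≤ 1) :
    ENNReal.ofReal (((∫ ξ, φ ξ) / 2) ^ 2 * (M * (b * (2 * w)))) ≤
      maximalIntegral1D (combMeasure b w (2 * N * τ) M) (truncatedProgression τ M) f := by
  have hI : 0 ≤ ∫ ξ, φ ξ := integral_nonneg φ.nonneg'
  set E : Set ℝ := ⋃ k ∈ Finset.range M, Metric.ball (-((k : ℝ) * (2 * N * τ))) w
  have hE : MeasurableSet E :=
    (isOpen_biUnion fun _ _ => Metric.isOpen_ball).measurableSet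
  have hEball : E ⊆ Metric.ball 0 1 := by
    refine Set.iUnion₂_subset fun k hk y hy => ?_
    have hkM : (k : ℝ) ≤ M := by exact_mod_cast (Finset.mem_range.1 hk).le
    have hpos : 0 ≤ (k : ℝ) * (2 * N * τ) := by positivity
    have hle : (k : ℝ) * (2 * N * τ) ≤ M * (2 * N * τ) := by gcongr
    rw [Metric.mem_ball, Real.dist_eq, abs_lt] at hy ⊢
    constructor <;> linarith
  have hlow : ∀ y ∈ E, ENNReal.ofReal (((∫ ξ, φ ξ) / 2) ^ 2) ≤
      ⨆ k : ℕ, ENNReal.ofReal (‖schrodingerEvolution1D f (truncatedProgression τ M k) y‖ ^ 2) := by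
    intro y hy
    obtain ⟨k, hk, hy⟩ := Set.mem_iUnion₂.1 hy
    rw [Finset.mem_range] at hk
    refine le_iSup_of_le k (ENNReal.ofReal_le_ofReal (pow_le_pow_left₀ (by positivity) ?_ 2))
    rw [truncatedProgression, if_pos hk]
    have hkM : (k : ℝ) ≤ M := by exact_mod_cast hk.le
    have hrOut := φ.rOut_pos
    refine half_integral_le_norm_schrodingerEvolution1D φ hf ?_ ?_
    · refine le_trans (mul_le_mul_of_nonneg_right ?_ hrOut.le) hw
      rw [Metric.mem_ball, Real.dist_eq] at hy
      convert hy.le using 2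
      ring
    · rw [abs_of_nonneg (by positivity)]
      refine le_trans ?_ hτM
      gcongr
  have hmeas : ENNReal.ofReal (M * (b * (2 * w))) ≤ combMeasure b w (2 * N * τ) M E := by
    rw [combMeasure, Measure.finsetSum_apply, ENNReal.ofReal_mul (by positivity),
      ENNReal.ofReal_natCast, ← nsmul_eq_mul]
    refine le_trans (le_of_eq ?_) (Finset.card_nsmul_le_sum (Finset.range M) _
      (ENNReal.ofReal (b * (2 * w))) fun k hk => ?_)
    · rw [Finset.card_range]
    · have hkE : Metric.ball (-((k : ℝ) * (2 * N * τ))) w ⊆ E :=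
        fun y hy => Set.mem_iUnion₂.2 ⟨k, hk, hy⟩
      rw [Measure.smul_apply, smul_eq_mul, Measure.restrict_apply hE,
        Set.inter_eq_right.2 hkE, Real.volume_ball, ENNReal.ofReal_mul hb]
  calc ENNReal.ofReal (((∫ ξ, φ ξ) / 2) ^ 2 * (M * (b * (2 * w))))
      ≤ ENNReal.ofReal (((∫ ξ, φ ξ) / 2) ^ 2) * combMeasure b w (2 * N * τ) M E := by
        rw [ENNReal.ofReal_mul (by positivity)]
        gcongr
    _ = ∫⁻ _ in E, ENNReal.ofReal (((∫ ξ, φ ξ) / 2) ^ 2) ∂combMeasure b w (2 * N * τ) M :=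
        (setLIntegral_const _ _).symm
    _ ≤ _ := setLIntegral_mono' hE hlow
    _ ≤ _ := lintegral_mono_set hEball

lemma critical_exponent_le {α r ρ : ℝ} (hα0 : 1 / 2 ≤ α) (hr : 0 < r) (hρ : ρ = min r (α / 2)) :
    (1 - α) / 2 + min ((2 * α - 1) / 4) (r * (2 * α - 1) / (2 * r + α)) ≤
      (2 * ρ + 1 - α) / (2 * (1 + 2 * ρ / α)) := by
  have hα : 0 < α := by linarith
  rcases le_total r (α / 2) with h | h
  · rw [min_eq_left h] at hρ
    subst hρ
    have : (1 - α) / 2 + ρ * (2 * α - 1) / (2 * ρ + α) =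
        (2 * ρ + 1 - α) / (2 * (1 + 2 * ρ / α)) := by field_simp; ring
    exact (add_le_add_right (min_le_right _ _) _).trans this.le
  · rw [min_eq_right h] at hρ
    subst hρ
    have : (1 - α) / 2 + (2 * α - 1) / 4 =
        (2 * (α / 2) + 1 - α) / (2 * (1 + 2 * (α / 2) / α)) := by field_simp; ring
    exact (add_le_add_right (min_le_left _ _) _).trans this.le

/-- one-dimensional lower bound (counterexample) for the fractal
sequential maximal estimate, `1/2 ≤ α ≤ 1`. -/
theorem fractal_sequential_counterexample_1D
    (α r : ℝ) (hα0 : 1 / 2 ≤ α) (hα : α ≤ 1) (hr : 0 < r) :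
    ∀ s : ℝ,
      s < (1 - α) / 2 + min ((2 * α - 1) / 4) (r * (2 * α - 1) / (2 * r + α)) →
      ∀ C : ℝ, 0 < C →
      ∃ (f : SchwartzMap ℝ ℂ) (t : ℕ → ℝ) (μ : Measure ℝ),
        MemLorentz r t 1 ∧ Tendsto t atTop (nhds 0) ∧ IsAlphaDimensional1D α 1 μ ∧
        ENNReal.ofReal (C * sobolevNormSq1D s ⇑f) < maximalIntegral1D μ t ⇑f := by
  intro s₀ hs₀ C hC
  have hαpos : 0 < α := by linarith
  obtain ⟨ρ, hρ⟩ : ∃ ρ, ρ = min r (α / 2) := ⟨_, rfl⟩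
  have hρpos : 0 < ρ := by rw [hρ]; exact lt_min hr (by linarith)
  have hρr : ρ ≤ r := hρ ▸ min_le_left _ _
  have hρα : ρ ≤ α / 2 := hρ ▸ min_le_right _ _
  set p : ℝ := 1 + 2 * ρ / α with hp
  have hppos : 0 < p := by positivity
  set s : ℝ := max s₀ 0
  have hs : 0 ≤ s := le_max_right _ _
  have hslt : s < (2 * ρ + 1 - α) / (2 * p) :=
    max_lt (hs₀.trans_le (critical_exponent_le hα0 hr hρ)) (by
      have : 0 < 2 * ρ + 1 - α := by linarith
      positivity)
  have he : 0 < 2 * ρ + 1 - α - 2 * p * s := by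
    rw [lt_div_iff₀ (by positivity)] at hslt
    linarith
  obtain ⟨l, hl1, hl⟩ : ∃ l : ℝ, 1 ≤ l ∧
      800 * C * 5 ^ s < l ^ (2 * ρ + 1 - α - 2 * p * s) :=
    ((eventually_ge_atTop 1).and ((tendsto_rpow_atTop he).eventually_gt_atTop _)).exists
  have hl0 : 0 < l := by linarith
  set q : ℝ := l ^ (2 * ρ / α) with hq
  have hq1 : 1 ≤ q := Real.one_le_rpow hl1 (by positivity)
  have hql : q ≤ l := by
    calc q ≤ l ^ (1 : ℝ) := Real.rpow_le_rpow_of_exponent_le hl1 (by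
          rw [div_le_one hαpos]; linarith)
      _ = l := Real.rpow_one l
  have hqα : q ^ α = l ^ (2 * ρ) := by
    rw [hq, ← Real.rpow_mul hl0.le, div_mul_cancel₀ _ hαpos.ne']
  set N : ℝ := l * q with hN
  have hNp : N = l ^ p := by rw [hN, hp, Real.rpow_add hl0, Real.rpow_one]
  have hN1 : 1 ≤ N := one_le_mul_of_one_le_of_one_le hl1 hq1
  have hlN : l ≤ N := le_mul_of_one_le_right hl0.le hq1
  have hpow1 : 1 ≤ l ^ (2 * ρ) := Real.one_le_rpow hl1 (by positivity)
  set M : ℕ := ⌊l ^ (2 * ρ)⌋₊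
  have hMle : (M : ℝ) ≤ l ^ (2 * ρ) := Nat.floor_le (by positivity)
  have hMpos : 0 < M := Nat.floor_pos.2 hpow1
  have hM1 : (1 : ℝ) ≤ M := by exact_mod_cast hMpos
  have hMge : l ^ (2 * ρ) / 2 ≤ M := by
    have := Nat.lt_floor_add_one (l ^ (2 * ρ))
    linarith
  have hMq : (M : ℝ) ≤ q := by
    rw [← hqα] at hMle
    exact hMle.trans ((Real.rpow_le_rpow_of_exponent_le hq1 hα).trans (Real.rpow_one q).le)
  set w : ℝ := 1 / (20 * l)
  have hw : 0 < w := by positivity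
  set τ : ℝ := 1 / (20 * l ^ 2 * M)
  have hτ : 0 < τ := by positivity
  have hMτ : M * τ = 1 / (20 * l ^ 2) := by simp only [τ]; field_simp
  have hMd : M * (2 * N * τ) = q / (10 * l) := by
    rw [hN]; simp only [τ]; field_simp; norm_num
  let φ : ContDiffBump N := ⟨l / 2, l, by positivity, by linarith⟩
  have hI : l ≤ ∫ ξ, φ ξ := by
    have := φ.measure_closedBall_le_integral (μ := volume)
    rw [Real.volume_real_closedBall (by positivity)] at this
    simpa [φ, mul_div_cancel₀] using this
  obtain ⟨f, hf⟩ := exists_schwartzMap_fourier_eq φ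
  refine ⟨f, truncatedProgression τ M, combMeasure (w ^ (α - 1) / 10) w (2 * N * τ) M,
    memLorentz_truncatedProgression hr.le hτ.le ?_, tendsto_truncatedProgression τ M,
    isAlphaDimensional1D_combMeasure hαpos.le hα hw ?_ hMpos ?_, ?_⟩
  · rw [hMτ]
    have hl2 : 1 / (20 * l ^ 2) ≤ l ^ (-2 : ℝ) := by
      rw [Real.rpow_neg hl0.le, Real.rpow_two, ← one_div]
      exact one_div_le_one_div_of_le (by positivity) (by nlinarith [sq_nonneg l])
    have hle1 : 1 / (20 * l ^ 2) ≤ 1 := hl2.trans (Real.rpow_le_one_of_one_le_of_nonpos hl1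
      (by norm_num))
    calc M * (1 / (20 * l ^ 2)) ^ r ≤ M * (1 / (20 * l ^ 2)) ^ ρ := by
          gcongr M * ?_
          exact Real.rpow_le_rpow_of_exponent_ge (by positivity) hle1 hρr
      _ ≤ l ^ (2 * ρ) * (l ^ (-2 : ℝ)) ^ ρ := by gcongr
      _ = 1 := by
          rw [← Real.rpow_mul hl0.le, ← Real.rpow_add hl0]
          simp
  · have hd : 2 * N * τ = q / (10 * l * M) := by
      rw [hN]; simp only [τ]; field_simp; norm_num
    rw [hd, le_div_iff₀ (by positivity)]
    have : 2 * w * (10 * l * M) = M := by simp only [w]; field_simp; norm_num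
    rwa [this]
  · rw [hMd]
    calc M * w ^ α ≤ q ^ α * w ^ α := by rw [hqα]; gcongr
      _ = (q * w) ^ α := (Real.mul_rpow (by positivity) hw.le).symm
      _ ≤ (q / (10 * l)) ^ α := by
          refine Real.rpow_le_rpow (by positivity) ?_ hαpos.le
          have : q * w = q / (10 * l) / 2 := by simp only [w]; field_simp; norm_num
          rw [this]
          exact half_le_self (by positivity)
  · refine lt_of_lt_of_le ?_ (ofReal_le_maximalIntegral1D (b := w ^ (α - 1) / 10) (by positivity)
      (by positivity) hτ.le φ hf ?_ ?_ ?_)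
    · have hIpos : 0 < ∫ ξ, φ ξ := hl0.trans_le hI
      rw [ENNReal.ofReal_lt_ofReal_iff (by positivity)]
      have hwα : l ^ (-α) / 20 ≤ w ^ α := by
        have h20 : (20 : ℝ)⁻¹ ≤ 20⁻¹ ^ α := by
          simpa using Real.rpow_le_rpow_of_exponent_ge (by norm_num : (0 : ℝ) < 20⁻¹)
            (by norm_num) hα
        have hwl : w = 20⁻¹ * l⁻¹ := by simp only [w]; field_simp
        rw [hwl, Real.mul_rpow (by norm_num) (by positivity), Real.inv_rpow hl0.le,
          ← Real.rpow_neg hl0.le, div_eq_inv_mul]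
        gcongr
      have hNs : (5 * N ^ 2) ^ s = 5 ^ s * l ^ (2 * p * s) := by
        rw [Real.mul_rpow (by norm_num) (by positivity), hNp, ← Real.rpow_natCast,
          ← Real.rpow_mul hl0.le, ← Real.rpow_mul hl0.le]
        congr 2
        push_cast
        ring
      have hkey : 20 * (C * (5 * N ^ 2) ^ s) < (∫ ξ, φ ξ) * (M * w ^ α) := calc
        20 * (C * (5 * N ^ 2) ^ s) = 800 * C * 5 ^ s * l ^ (2 * p * s) / 40 := by
          rw [hNs]; ring
        _ < l ^ (2 * ρ + 1 - α - 2 * p * s) * l ^ (2 * p * s) / 40 := by gcongr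
        _ = l * (l ^ (2 * ρ) / 2 * (l ^ (-α) / 20)) := by
          rw [← Real.rpow_add hl0, sub_add_cancel, sub_eq_add_neg, Real.rpow_add hl0,
            Real.rpow_add hl0, Real.rpow_one]
          ring
        _ ≤ (∫ ξ, φ ξ) * (M * w ^ α) := by gcongr
      have hwsplit : w ^ (α - 1) * w = w ^ α := by
        rw [← Real.rpow_add_one hw.ne', sub_add_cancel]
      calc C * sobolevNormSq1D s₀ f ≤ C * ((5 * N ^ 2) ^ s * ∫ ξ, φ ξ) := by
            gcongr
            exact sobolevNormSq1D_le hN1 hs (le_max_left _ _) φ hlN hf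
        _ = 20 * (C * (5 * N ^ 2) ^ s) * (∫ ξ, φ ξ) / 20 := by ring
        _ < (∫ ξ, φ ξ) * (M * w ^ α) * (∫ ξ, φ ξ) / 20 := by gcongr
        _ = ((∫ ξ, φ ξ) / 2) ^ 2 * (M * (w ^ (α - 1) / 10 * (2 * w))) := by
            rw [← hwsplit]; ring
    · exact (show w * l = 1 / 20 by simp only [w]; field_simp).le
    · exact (show M * τ * l ^ 2 = 1 / 20 by rw [hMτ]; field_simp).le
    · rw [hMd]
      have h₁ : q / (10 * l) ≤ 1 / 10 := by
        rw [div_le_iff₀ (by positivity)]; linarith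
      have h₂ : w ≤ 1 / 20 :=
        one_div_le_one_div_of_le (by norm_num) (by linarith)
      linarith
end
end

section
/- Let φ : ℝ → ℂ be a Schwartz function whose Fourier transform φ̂ is supported in [−1,1] and such that φ(0) = 1. Then there exists c > 0 (depending only on φ) with the following property: for all R ≥ 1 and 1 ≤ S ≤ R, if g : ℝ → ℂ is defined by ĝ(ξ) = S^{−1} φ̂((ξ − R)/S), then for every x ∈ ℝ and t ∈ ℝ satisfying S|x + 2Rt| ≤ c and S²|t| ≤ c one has |e^{itΔ}g(x)| ≥ 1/2. -/
open MeasureTheory FourierTransform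
open scoped ENNReal

noncomputable section

/-- Multiplying an integrable function supported in `[-1, 1]` by the phase
`e(a η + b η²)` changes its integral by at most `2π (|a| + |b|)` times its `L¹` norm. -/
theorem norm_integral_mul_exp_sub_integral_le {F : ℝ → ℂ} (hF : Integrable F)
    (hsupp : Function.support F ⊆ Set.Icc (-1 : ℝ) 1) (a b : ℝ) :
    ‖(∫ η, F η * Complex.exp (Complex.I * ((2 * Real.pi * (a * η + b * η ^ 2) : ℝ) : ℂ)))
        - ∫ η, F η‖ ≤ 2 * Real.pi * (|a| + |b|) * ∫ η, ‖F η‖ := by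
  have hint : Integrable fun η : ℝ =>
      F η * Complex.exp (Complex.I * ((2 * Real.pi * (a * η + b * η ^ 2) : ℝ) : ℂ)) := by
    refine hF.mul_bdd (c := 1) (Continuous.aestronglyMeasurable (by fun_prop)) (.of_forall fun η => ?_)
    rw [mul_comm Complex.I, Complex.norm_exp_ofReal_mul_I]
  rw [← integral_sub hint hF, ← integral_const_mul]
  refine norm_integral_le_of_norm_le (hF.norm.const_mul _) (.of_forall fun η => ?_)
  by_cases hη : F η = 0
  · simp [hη]
  have hη' : |η| ≤ 1 := abs_le.mpr (hsupp hη)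
  have hphase : |2 * Real.pi * (a * η + b * η ^ 2)| ≤ 2 * Real.pi * (|a| + |b|) := by
    rw [abs_mul, abs_of_pos Real.two_pi_pos]
    gcongr
    refine (abs_add_le _ _).trans ?_
    rw [abs_mul, abs_mul, abs_pow]
    exact add_le_add (mul_le_of_le_one_right (abs_nonneg a) hη')
      (mul_le_of_le_one_right (abs_nonneg b) (pow_le_one₀ (abs_nonneg η) hη'))
  rw [← mul_sub_one, norm_mul, mul_comm]
  gcongr
  exact Real.norm_exp_I_mul_ofReal_sub_one_le.trans hphase

/-- The norm of the Schrödinger evolution of a wave packet, after rescaling frequencies. -/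
theorem norm_integral_wave_packet_eq (F : ℝ → ℂ) {S : ℝ} (hS : 0 < S) (R x t : ℝ) :
    ‖∫ ξ : ℝ, (((S⁻¹ : ℝ) : ℂ) * F ((ξ - R) / S)) *
        Complex.exp (2 * Real.pi * Complex.I * ((x * ξ + t * ξ ^ 2 : ℝ) : ℂ))‖ =
      ‖∫ η, F η * Complex.exp (Complex.I *
        ((2 * Real.pi * (S * (x + 2 * R * t) * η + S ^ 2 * t * η ^ 2) : ℝ) : ℂ))‖ := by
  set G : ℝ → ℂ := fun η => F η * Complex.exp (Complex.I *
    ((2 * Real.pi * (S * (x + 2 * R * t) * η + S ^ 2 * t * η ^ 2) : ℝ) : ℂ)) with hG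
  set A : ℂ := Complex.exp (((2 * Real.pi * (x * R + t * R ^ 2) : ℝ) : ℂ) * Complex.I) with hA
  have hS' : (S : ℂ) ≠ 0 := by exact_mod_cast hS.ne'
  have hpt : ∀ ξ : ℝ, (((S⁻¹ : ℝ) : ℂ) * F ((ξ - R) / S)) *
      Complex.exp (2 * Real.pi * Complex.I * ((x * ξ + t * ξ ^ 2 : ℝ) : ℂ)) =
      ((S⁻¹ : ℝ) : ℂ) * A * G ((ξ - R) / S) := by
    intro ξ
    have hexp : Complex.exp (2 * Real.pi * Complex.I * ((x * ξ + t * ξ ^ 2 : ℝ) : ℂ)) =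
        A * Complex.exp (Complex.I * ((2 * Real.pi * (S * (x + 2 * R * t) * ((ξ - R) / S) +
          S ^ 2 * t * ((ξ - R) / S) ^ 2) : ℝ) : ℂ)) := by
      rw [hA, ← Complex.exp_add]
      congr 1
      push_cast
      field_simp
      ring
    rw [hexp]
    simp only [hG]
    ring
  have hA1 : ‖A‖ = 1 := Complex.norm_exp_ofReal_mul_I _
  simp_rw [hpt]
  rw [integral_const_mul, integral_sub_right_eq_self (fun ξ => G (ξ / S)) R,
    Measure.integral_comp_div, norm_mul, norm_mul, hA1, norm_smul, Complex.norm_real,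
    Real.norm_eq_abs, Real.norm_eq_abs, abs_abs, abs_inv, mul_one,
    inv_mul_cancel_left₀ (abs_pos.mpr hS.ne').ne']

/-- single wave packet bound.  If `ĝ(ξ) = S⁻¹ φ̂((ξ-R)/S)` with `φ`
Schwartz, `supp φ̂ ⊆ [-1,1]` and `φ(0) = 1`, then there is `c > 0` such that
`|e^{itΔ}g(x)| ≥ 1/2` whenever `S|x+2Rt| ≤ c` and `S²|t| ≤ c`. -/
theorem wave_packet_lower_bound
    (φ : SchwartzMap ℝ ℂ)
    (hsupp : Function.support (𝓕 ⇑φ) ⊆ Set.Icc (-1 : ℝ) 1)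
    (hφ0 : φ 0 = 1) :
    ∃ c : ℝ, 0 < c ∧
      ∀ R S : ℝ, 1 ≤ R → 1 ≤ S → S ≤ R →
      ∀ x t : ℝ, S * |x + 2 * R * t| ≤ c → S ^ 2 * |t| ≤ c →
        (1 : ℝ) / 2 ≤
          ‖∫ ξ : ℝ, (((S⁻¹ : ℝ) : ℂ) * 𝓕 ⇑φ ((ξ - R) / S)) *
            Complex.exp (2 * Real.pi * Complex.I * ((x * ξ + t * ξ ^ 2 : ℝ) : ℂ))‖ := by
  have hF : Integrable (𝓕 ⇑φ) := by
    rw [← SchwartzMap.fourier_coe]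
    exact (𝓕 φ).integrable
  have hone : ∫ η, 𝓕 ⇑φ η = 1 := by
    have hinv := congrFun (φ.continuous.fourierInv_fourier_eq φ.integrable hF) 0
    rw [Real.fourierInv_eq'] at hinv
    simpa [hφ0] using hinv
  set M : ℝ := ∫ η, ‖𝓕 ⇑φ η‖ with hM
  have hM0 : 0 ≤ M := integral_nonneg fun _ => norm_nonneg _
  have hpi := Real.pi_pos
  refine ⟨1 / (8 * Real.pi * (M + 1)), by positivity, fun R S _ hS _ x t hx ht => ?_⟩
  have hS0 : 0 < S := by linarith
  rw [norm_integral_wave_packet_eq _ hS0]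
  have hclose := norm_integral_mul_exp_sub_integral_le hF hsupp (S * (x + 2 * R * t)) (S ^ 2 * t)
  rw [hone, abs_mul, abs_mul, abs_of_pos hS0, abs_of_pos (pow_pos hS0 2), ← hM] at hclose
  have hsmall : 2 * Real.pi * (S * |x + 2 * R * t| + S ^ 2 * |t|) * M ≤ 1 / 2 := by
    calc 2 * Real.pi * (S * |x + 2 * R * t| + S ^ 2 * |t|) * M
        ≤ 2 * Real.pi * (1 / (8 * Real.pi * (M + 1)) + 1 / (8 * Real.pi * (M + 1))) * (M + 1) := by
          gcongr
          linarith
      _ = 1 / 2 := by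
          field_simp
          norm_num
  have htri := norm_sub_norm_le (1 : ℂ) (∫ η, 𝓕 ⇑φ η * Complex.exp (Complex.I *
    ((2 * Real.pi * (S * (x + 2 * R * t) * η + S ^ 2 * t * η ^ 2) : ℝ) : ℂ)))
  rw [norm_one, norm_sub_rev] at htri
  linarith
end
end

section
/- Let q be an odd positive integer and let a, b be integers with gcd(a, q) = 1. Then | Σ_{m=0}^{q−1} e^{2πi (a m² + b m)/q} | = √q. -/
open scoped ENNReal

open scoped ComplexConjugate

/-- A quadratic exponential sum against a primitive additive character of a finite commutative
ring has squared modulus the order of the ring when twice the leading coefficient is a unit. -/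
theorem AddChar.IsPrimitive.norm_sq_sum_quadratic {R : Type*} [CommRing R] [Fintype R]
    {ψ : AddChar R ℂ} (hψ : ψ.IsPrimitive) {a : R} (ha : IsUnit (2 * a)) (b : R) :
    ‖∑ x, ψ (a * x ^ 2 + b * x)‖ ^ 2 = Fintype.card R := by
  classical
  have shift (y : R) : ∑ x, ψ (a * x ^ 2 + b * x) * conj (ψ (a * y ^ 2 + b * y)) =
      ∑ h, ψ (a * h ^ 2 + b * h) * ψ (y * (2 * a * h)) := by
    rw [← Equiv.sum_comp (Equiv.addLeft y)]
    refine Finset.sum_congr rfl fun h _ ↦ ?_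
    rw [← AddChar.map_neg_eq_conj, ← AddChar.map_add_eq_mul, ← AddChar.map_add_eq_mul,
      Equiv.coe_addLeft]
    congr 1
    ring
  have key : (∑ x, ψ (a * x ^ 2 + b * x)) * conj (∑ y, ψ (a * y ^ 2 + b * y)) =
      Fintype.card R := by
    rw [map_sum, Finset.sum_mul_sum, Finset.sum_comm]
    simp_rw [shift]
    rw [Finset.sum_comm]
    simp_rw [← Finset.mul_sum, AddChar.sum_mulShift _ hψ, ha.mul_right_eq_zero]
    simp
  rw [Complex.mul_conj'] at key
  exact_mod_cast key

/-- A sum over `ZMod q` is a sum over the representatives `0, …, q - 1`. -/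
theorem ZMod.sum_eq_sum_range {M : Type*} [AddCommMonoid M] (q : ℕ) [NeZero q] (f : ZMod q → M) :
    ∑ x, f x = ∑ m ∈ Finset.range q, f m :=
  Finset.sum_nbij' ZMod.val (fun m ↦ (m : ZMod q)) (by simp [ZMod.val_lt]) (by simp) (by simp)
    (fun m hm ↦ ZMod.val_cast_of_lt (Finset.mem_range.mp hm)) (by simp)

/-- complete quadratic Gauss sums with a linear term have absolute
value `√q` when `q` is odd and `gcd(a,q) = 1`. -/
theorem gauss_sum_abs (q : ℕ) (hq : Odd q) (hq0 : 0 < q) (a b : ℤ)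
    (hgcd : Int.gcd a (q : ℤ) = 1) :
    ‖∑ m ∈ Finset.range q,
        Complex.exp (2 * Real.pi * Complex.I *
          ((a * (m : ℤ) ^ 2 + b * (m : ℤ) : ℤ) : ℂ) / (q : ℂ))‖ = Real.sqrt q := by
  have : NeZero q := ⟨hq0.ne'⟩
  have h2 : IsUnit (2 : ZMod q) := by
    exact_mod_cast (ZMod.isUnit_iff_coprime 2 q).mpr hq.coprime_two_left
  have ha : IsUnit (a : ZMod q) := by
    rw [ZMod.coe_int_isUnit_iff_isCoprime, isCoprime_comm, Int.isCoprime_iff_gcd_eq_one]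
    exact hgcd
  have hsum := (ZMod.isPrimitive_stdAddChar q).norm_sq_sum_quadratic (h2.mul ha) (b : ZMod q)
  rw [ZMod.card, ZMod.sum_eq_sum_range] at hsum
  rw [← hsum, Real.sqrt_sq (norm_nonneg _)]
  congr 1
  refine Finset.sum_congr rfl fun m _ ↦ ?_
  rw [← ZMod.stdAddChar_coe]
  push_cast
  rfl
end

section
/- Let n ≥ 2 and let c > 0 be a fixed small constant. Let α satisfy (3n+1)/4 ≤ α ≤ n and α ≥ n−1, and let 1/2 < σ ≤ 1. Define A by A(n+1) = 2α − n + 2σ(n − α + 1/2), set B = σ, and for R ≥ 1 set S = R^{σ}, D = R^{1+B−A}, Q = R^{2A−B−1}; assume Q ≥ 1. Let 𝒯 be any finite collection of tubes T_j = [a_j, a_j + R/S²] × B_{n−1}(x'_j, c/R) ⊂ ℝ × ℝ^{n−1} with a_j ∈ [0,1] and x'_j ∈ [0,1]^{n−1}, whose centers are separated: |x'_j − x'_k| > 1/(D Q^{n/(n−1)}) for all j ≠ k. Define the measure ν(E) = λ(E ∩ ⋃_j T_j) · R^{n−α}, where λ is n-dimensional Lebesgue measure. Then there exists a constant C = C(n,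 α, σ, c), independent of R and of the collection 𝒯, such that ν(B(x,ρ)) ≤ C ρ^{α} for every x ∈ ℝ^n and every ρ > 0; that is, ν is an α-dimensional measure with constant uniformly bounded in R. -/
open MeasureTheory
open scoped ENNReal

noncomputable section

/-- A volume packing bound: an `s`-separated finite family in a ball of radius `r` in `ℝ^m` has at
most `(1 + 2r/s)^m` members. -/
theorem card_le_of_separated_of_mem_ball {m : ℕ} {ι : Type*} (J : Finset ι)
    (p : ι → EuclideanSpace ℝ (Fin m)) (y : EuclideanSpace ℝ (Fin m)) {r s : ℝ}
    (hr : 0 ≤ r) (hs : 0 < s) (hp : ∀ j ∈ J, dist (p j) y < r)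
    (hsep : ∀ j ∈ J, ∀ k ∈ J, j ≠ k → s < dist (p j) (p k)) :
    (J.card : ℝ) ≤ (1 + 2 * r / s) ^ m := by
  set V := volume (Metric.ball (0 : EuclideanSpace ℝ (Fin m)) 1)
  have hV0 : V ≠ 0 := (Metric.measure_ball_pos volume _ one_pos).ne'
  have hVt : V ≠ ∞ := measure_ball_lt_top.ne
  have hball (z : EuclideanSpace ℝ (Fin m)) {t : ℝ} (ht : 0 < t) :
      volume (Metric.ball z t) = ENNReal.ofReal (t ^ m) * V := by
    rw [Measure.addHaar_ball_of_pos _ _ ht, finrank_euclideanSpace_fin]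
  have hsub : ⋃ j ∈ J, Metric.ball (p j) (s / 2) ⊆ Metric.ball y (r + s / 2) := by
    refine Set.iUnion₂_subset fun j hj => Metric.ball_subset_ball' ?_
    linarith [hp j hj]
  have hdisj : Set.PairwiseDisjoint (J : Set ι) fun j => Metric.ball (p j) (s / 2) := by
    intro j hj k hk hjk
    refine Metric.ball_disjoint_ball ?_
    linarith [hsep j hj k hk hjk]
  have hle := measure_mono (μ := volume) hsub
  rw [measure_biUnion_finset hdisj fun _ _ => measurableSet_ball, hball y (by positivity),
    Finset.sum_congr rfl fun j _ => hball (p j) (half_pos hs), Finset.sum_const, nsmul_eq_mul,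
    ← mul_assoc, ENNReal.mul_le_mul_iff_left hV0 hVt, ← ENNReal.ofReal_natCast,
    ← ENNReal.ofReal_mul (by positivity), ENNReal.ofReal_le_ofReal_iff (by positivity)] at hle
  rw [show 1 + 2 * r / s = (r + s / 2) / (s / 2) by field_simp; ring, div_pow,
    le_div_iff₀ (by positivity)]
  exact hle

/-- The volume of the part of a union of tubes lying in a ball: at most
`(1 + 2(ρ + w)/s)^m` of the tubes of radius `w` with `s`-separated centers meet the ball. -/
theorem volume_ball_inter_iUnion_tubes_le {m : ℕ} {ι : Type*} (J : Finset ι) (a : ι → ℝ)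
    (p : ι → EuclideanSpace ℝ (Fin m)) {L w s ρ : ℝ} (hL : 0 ≤ L) (hw : 0 < w) (hs : 0 < s)
    (hρ : 0 < ρ) (hsep : ∀ j ∈ J, ∀ k ∈ J, j ≠ k → s < dist (p j) (p k))
    (x : ℝ × EuclideanSpace ℝ (Fin m)) :
    volume (Metric.ball x ρ ∩ ⋃ j ∈ J, Set.Icc (a j) (a j + L) ×ˢ Metric.ball (p j) w) ≤
      ENNReal.ofReal ((1 + 2 * (ρ + w) / s) ^ m * (min (2 * ρ) L * w ^ m *
        volume.real (Metric.ball (0 : EuclideanSpace ℝ (Fin m)) 1))) := by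
  classical
  set K := J.filter fun j => dist (p j) x.2 < ρ + w
  have hcard : (K.card : ℝ) ≤ (1 + 2 * (ρ + w) / s) ^ m :=
    card_le_of_separated_of_mem_ball K p x.2 (by positivity) hs
      (fun j hj => (Finset.mem_filter.1 hj).2)
      fun j hj k hk => hsep j (Finset.mem_filter.1 hj).1 k (Finset.mem_filter.1 hk).1
  have hsub : Metric.ball x ρ ∩ ⋃ j ∈ J, Set.Icc (a j) (a j + L) ×ˢ Metric.ball (p j) w ⊆
      ⋃ j ∈ K, (Metric.ball x.1 ρ ∩ Set.Icc (a j) (a j + L)) ×ˢ Metric.ball (p j) w := by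
    rintro z ⟨hz, hzT⟩
    obtain ⟨j, hj, hz1, hz2⟩ := Set.mem_iUnion₂.1 hzT
    rw [Metric.mem_ball, Prod.dist_eq, max_lt_iff] at hz
    refine Set.mem_iUnion₂.2 ⟨j, Finset.mem_filter.2 ⟨hj, ?_⟩, ⟨hz.1, hz1⟩, hz2⟩
    have := dist_triangle_left (p j) x.2 z.2
    rw [Metric.mem_ball] at hz2
    linarith [hz.2]
  have hpiece (j : ι) :
      volume ((Metric.ball x.1 ρ ∩ Set.Icc (a j) (a j + L)) ×ˢ Metric.ball (p j) w) ≤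
        ENNReal.ofReal (min (2 * ρ) L * w ^ m *
          volume.real (Metric.ball (0 : EuclideanSpace ℝ (Fin m)) 1)) := by
    have h0 : 0 ≤ min (2 * ρ) L := le_min (by positivity) hL
    rw [Measure.volume_eq_prod, Measure.prod_prod, Measure.addHaar_ball_of_pos _ _ hw,
      finrank_euclideanSpace_fin, ENNReal.ofReal_mul (by positivity), ENNReal.ofReal_mul h0,
      ofReal_measureReal measure_ball_lt_top.ne, mul_assoc]
    gcongr
    rw [ENNReal.ofReal_min]
    refine le_min ((measure_mono Set.inter_subset_left).trans_eq (Real.volume_ball _ _))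
      ((measure_mono Set.inter_subset_right).trans_eq ?_)
    rw [Real.volume_Icc, add_sub_cancel_left]
  calc _ ≤ _ := measure_mono hsub
    _ ≤ _ := measure_biUnion_finset_le _ _
    _ ≤ _ := Finset.sum_le_card_nsmul _ _ _ fun j _ => hpiece j
    _ ≤ _ := by
      rw [nsmul_eq_mul, ← ENNReal.ofReal_natCast, ← ENNReal.ofReal_mul (by positivity)]
      refine ENNReal.ofReal_le_ofReal (mul_le_mul_of_nonneg_right hcard ?_)
      have h0 : 0 ≤ min (2 * ρ) L := le_min (by positivity) hL
      positivity

theorem min_le_rpow_mul_rpow {u v d : ℝ} (hu : 0 < u) (hv : 0 < v) (hd0 : 0 ≤ d) (hd1 : d ≤ 1) :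
    min u v ≤ u ^ (1 - d) * v ^ d := by
  have h0 : 0 < min u v := lt_min hu hv
  calc min u v = min u v ^ (1 - d) * min u v ^ d := by
        rw [← Real.rpow_add h0, sub_add_cancel, Real.rpow_one]
    _ ≤ _ := mul_le_mul
        (Real.rpow_le_rpow h0.le (min_le_left _ _) (by linarith))
        (Real.rpow_le_rpow h0.le (min_le_right _ _) hd0) (by positivity) (by positivity)

/-- Tubes of length `L` and radius `c/R` with `s`-separated centers carry, after weighting by
`R^d`, a measure of dimension `m + 1 - d`, provided that `s^{-m} L^d R^{d-m} = 1`. -/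
theorem volume_tubes_mul_rpow_le {m : ℕ} {ι : Type*} (J : Finset ι) (a : ι → ℝ)
    (p : ι → EuclideanSpace ℝ (Fin m)) {c d L R s ρ : ℝ} (hm : d ≤ m) (hd0 : 0 ≤ d) (hd1 : d ≤ 1)
    (hc : 0 < c) (hR : 0 < R) (hL : 0 < L) (hs : 0 < s) (hρ : 0 < ρ)
    (hscale : (1 / s) ^ m * L ^ d * (1 / R) ^ m * R ^ d = 1)
    (hsep : ∀ j ∈ J, ∀ k ∈ J, j ≠ k → s < dist (p j) (p k))
    (x : ℝ × EuclideanSpace ℝ (Fin m)) :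
    volume (Metric.ball x ρ ∩ ⋃ j ∈ J, Set.Icc (a j) (a j + L) ×ˢ Metric.ball (p j) (c / R)) *
        ENNReal.ofReal (R ^ d) ≤
      ENNReal.ofReal (2 * volume.real (Metric.ball (0 : EuclideanSpace ℝ (Fin m)) 1) *
        (1 + 2 ^ m * c ^ m * (1 + (2 * (1 + c)) ^ m)) * ρ ^ ((m : ℝ) + 1 - d)) := by
  set v := volume.real (Metric.ball (0 : EuclideanSpace ℝ (Fin m)) 1) with hv
  have hv0 : 0 ≤ v := measureReal_nonneg
  have hρα : 0 < ρ ^ ((m : ℝ) + 1 - d) := Real.rpow_pos_of_pos hρ _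
  have hRd : 0 < R ^ d := Real.rpow_pos_of_pos hR _
  rcases le_total (ρ * R) 1 with hsmall | hlarge
  · have hball : volume (Metric.ball x ρ) = ENNReal.ofReal (2 * ρ * (ρ ^ m * v)) := by
      rw [← Prod.mk.eta (p := x), ← ball_prod_same, Measure.volume_eq_prod, Measure.prod_prod,
        Real.volume_ball, Measure.addHaar_ball_of_pos _ _ hρ, finrank_euclideanSpace_fin,
        ENNReal.ofReal_mul (p := 2 * ρ) (by positivity),
        ENNReal.ofReal_mul (p := ρ ^ m) (by positivity), hv, ofReal_measureReal measure_ball_lt_top.ne]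
    refine (mul_le_mul_left (measure_mono Set.inter_subset_left) _).trans ?_
    rw [hball, ← ENNReal.ofReal_mul (by positivity)]
    refine ENNReal.ofReal_le_ofReal ?_
    have hpow : ρ ^ m * ρ * R ^ d ≤ ρ ^ ((m : ℝ) + 1 - d) := by
      have hone : (ρ * R) ^ d ≤ 1 := Real.rpow_le_one (by positivity) hsmall hd0
      rw [Real.mul_rpow hρ.le hR.le] at hone
      calc ρ ^ m * ρ * R ^ d = ρ ^ ((m : ℝ) + 1 - d) * (ρ ^ d * R ^ d) := by
            rw [← mul_assoc, ← Real.rpow_add hρ, sub_add_cancel, Real.rpow_add_one hρ.ne',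
              Real.rpow_natCast]
        _ ≤ _ := mul_le_of_le_one_right hρα.le hone
    calc 2 * ρ * (ρ ^ m * v) * R ^ d = 2 * v * (ρ ^ m * ρ * R ^ d) := by ring
      _ ≤ 2 * v * ρ ^ ((m : ℝ) + 1 - d) := by gcongr
      _ ≤ _ := by
        refine mul_le_mul_of_nonneg_right ?_ hρα.le
        refine le_mul_of_one_le_right (by positivity) (le_add_of_nonneg_right ?_)
        positivity
  · have hM0 : 0 < min ρ L := lt_min hρ hL
    have hM2 : 0 < min (2 * ρ) L := lt_min (by positivity) hL
    refine (mul_le_mul_left (volume_ball_inter_iUnion_tubes_le J a p hL.le (div_pos hc hR) hs hρ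
      hsep x) _).trans ?_
    rw [← ENNReal.ofReal_mul (by positivity)]
    refine ENNReal.ofReal_le_ofReal ?_
    have hmin : min (2 * ρ) L ≤ 2 * min ρ L := by
      rw [mul_min_of_nonneg _ _ zero_le_two]
      exact min_le_min_left _ (by linarith)
    have hone : min ρ L * ((1 / R) ^ m * R ^ d) ≤ ρ ^ ((m : ℝ) + 1 - d) := by
      have h1 : 1 ≤ (ρ * R) ^ ((m : ℝ) - d) := Real.one_le_rpow hlarge (by linarith)
      rw [Real.mul_rpow hρ.le hR.le, Real.rpow_sub hR, Real.rpow_natCast] at h1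
      calc min ρ L * ((1 / R) ^ m * R ^ d) ≤ ρ * ((1 / R) ^ m * R ^ d) := by
            gcongr
            exact min_le_left _ _
        _ ≤ ρ * ((1 / R) ^ m * R ^ d) * (ρ ^ ((m : ℝ) - d) * (R ^ m / R ^ d)) :=
            le_mul_of_one_le_right (by positivity) h1
        _ = ρ ^ ((m : ℝ) - d) * ρ := by rw [one_div, inv_pow]; field_simp
        _ = _ := by rw [← Real.rpow_add_one hρ.ne']; ring_nf
    have hmany : (ρ / s) ^ m * (min ρ L * ((1 / R) ^ m * R ^ d)) ≤ ρ ^ ((m : ℝ) + 1 - d) := by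
      calc (ρ / s) ^ m * (min ρ L * ((1 / R) ^ m * R ^ d))
          ≤ (ρ / s) ^ m * (ρ ^ (1 - d) * L ^ d * ((1 / R) ^ m * R ^ d)) := by
            gcongr
            exact min_le_rpow_mul_rpow hρ hL hd0 hd1
        _ = ρ ^ m * ρ ^ (1 - d) * ((1 / s) ^ m * L ^ d * (1 / R) ^ m * R ^ d) := by
            rw [div_eq_mul_one_div ρ s, mul_pow]; ring
        _ = _ := by
            rw [hscale, mul_one, ← Real.rpow_natCast ρ m, ← Real.rpow_add hρ]; ring_nf
    have hcount : (1 + 2 * (ρ + c / R) / s) ^ m ≤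
        2 ^ m * (1 + (2 * (1 + c)) ^ m * (ρ / s) ^ m) := by
      have hcR : c / R ≤ c * ρ := by
        rw [div_le_iff₀ hR, mul_assoc]
        exact le_mul_of_one_le_right hc.le hlarge
      calc (1 + 2 * (ρ + c / R) / s) ^ m ≤ (1 + 2 * (1 + c) * (ρ / s)) ^ m := by
            rw [← mul_div_assoc, mul_assoc 2]
            gcongr (1 + 2 * ?_ / s) ^ m
            linarith
        _ ≤ 2 ^ (m - 1) * (1 ^ m + (2 * (1 + c) * (ρ / s)) ^ m) :=
            add_pow_le zero_le_one (by positivity) m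
        _ ≤ 2 ^ m * (1 + (2 * (1 + c)) ^ m * (ρ / s) ^ m) := by
            rw [one_pow, mul_pow]
            gcongr
            · exact one_le_two
            · exact Nat.sub_le m 1
    calc _ ≤ 2 ^ m * (1 + (2 * (1 + c)) ^ m * (ρ / s) ^ m) *
          (2 * min ρ L * (c / R) ^ m * v) * R ^ d := by gcongr
      _ = 2 * v * (2 ^ m * c ^ m * (min ρ L * ((1 / R) ^ m * R ^ d) +
          (2 * (1 + c)) ^ m * ((ρ / s) ^ m * (min ρ L * ((1 / R) ^ m * R ^ d))))) := by
        rw [div_eq_mul_one_div c R, mul_pow c]; ring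
      _ ≤ 2 * v * (2 ^ m * c ^ m * (ρ ^ ((m : ℝ) + 1 - d) +
          (2 * (1 + c)) ^ m * ρ ^ ((m : ℝ) + 1 - d))) := by gcongr
      _ = 2 * v * (2 ^ m * c ^ m * (1 + (2 * (1 + c)) ^ m)) * ρ ^ ((m : ℝ) + 1 - d) := by ring
      _ ≤ _ := by gcongr; linarith

/-- Scaling 1, case `B = σ`, `Q ≫ 1`: for any finite collection of
tubes `T_j = [a_j, a_j + R/S²] × B_{n-1}(x'_j, c/R)` with `a_j ∈ [0,1]`,
`x'_j ∈ [0,1]^{n-1}`, whose centers are `1/(DQ^{n/(n-1)})`-separated, the measure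
`ν(E) = λ(E ∩ ⋃_j T_j) R^{n-α}` is `α`-dimensional with constant independent of `R`
and of the collection.  Here `A(n+1) = 2α - n + 2σ(n-α+1/2)`, `B = σ`, `S = R^σ`,
`D = R^{1+B-A}`, `Q = R^{2A-B-1} ≥ 1`. -/
theorem scaling1_tubes_alpha_dimensional
    (n : ℕ) (hn : 2 ≤ n) (c : ℝ) (hc : 0 < c)
    (α σ A B : ℝ)
    (hα1 : (3 * (n : ℝ) + 1) / 4 ≤ α) (hα2 : α ≤ (n : ℝ)) (hα3 : (n : ℝ) - 1 ≤ α)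
    (hσ1 : 1 / 2 < σ) (hσ2 : σ ≤ 1)
    (hA : A * ((n : ℝ) + 1) = 2 * α - n + 2 * σ * ((n : ℝ) - α + 1 / 2))
    (hB : B = σ) :
    ∃ C : ℝ, 0 < C ∧ ∀ R : ℝ, 1 ≤ R →
      1 ≤ R ^ (2 * A - B - 1) →
      ∀ (ι : Type) (J : Finset ι) (a : ι → ℝ)
        (x' : ι → EuclideanSpace ℝ (Fin (n - 1))),
        (∀ j ∈ J, a j ∈ Set.Icc (0 : ℝ) 1) →
        (∀ j ∈ J, ∀ i, x' j i ∈ Set.Icc (0 : ℝ) 1) →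
        (∀ j ∈ J, ∀ k ∈ J, j ≠ k →
          1 / (R ^ (1 + B - A) * (R ^ (2 * A - B - 1)) ^ ((n : ℝ) / ((n : ℝ) - 1))) <
            dist (x' j) (x' k)) →
        ∀ (x : ℝ × EuclideanSpace ℝ (Fin (n - 1))) (ρ : ℝ), 0 < ρ →
          volume (Metric.ball x ρ ∩
              ⋃ j ∈ J, Set.Icc (a j) (a j + R / (R ^ σ) ^ 2) ×ˢ Metric.ball (x' j) (c / R)) *
            ENNReal.ofReal (R ^ ((n : ℝ) - α)) ≤
          ENNReal.ofReal (C * ρ ^ α) := by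
  obtain ⟨m, rfl⟩ : ∃ m, n = m + 1 := ⟨n - 1, by omega⟩
  have hm : (1 : ℝ) ≤ m := by exact_mod_cast (by omega : 1 ≤ m)
  push_cast at hα1 hα2 hα3 hA ⊢
  subst hB
  have hv : 0 < volume.real (Metric.ball (0 : EuclideanSpace ℝ (Fin m)) 1) :=
    ENNReal.toReal_pos (Metric.measure_ball_pos volume _ one_pos).ne' measure_ball_lt_top.ne
  refine ⟨2 * volume.real (Metric.ball (0 : EuclideanSpace ℝ (Fin m)) 1) *
    (1 + 2 ^ m * c ^ m * (1 + (2 * (1 + c)) ^ m)), by positivity, ?_⟩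
  intro R hR _ ι J a x' _ _ hsep x ρ hρ
  have hR0 : 0 < R := by linarith
  have hscale : (1 / (1 / (R ^ (1 + B - A) *
      (R ^ (2 * A - B - 1)) ^ (((m : ℝ) + 1) / ((m : ℝ) + 1 - 1))))) ^ m *
      (R / (R ^ B) ^ 2) ^ ((m : ℝ) + 1 - α) * (1 / R) ^ m * R ^ ((m : ℝ) + 1 - α) = 1 := by
    have hL : R / (R ^ B) ^ 2 = R ^ (1 - 2 * B) := by
      rw [Real.rpow_sub hR0, Real.rpow_one, mul_comm 2 B, Real.rpow_mul hR0.le, Real.rpow_two]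
    have hRm : (1 / R) ^ m = R ^ (-(m : ℝ)) := by
      rw [Real.rpow_neg hR0.le, Real.rpow_natCast, one_div, inv_pow]
    rw [one_div_one_div, hL, hRm, ← Real.rpow_natCast (_ * _) m, ← Real.rpow_mul hR0.le,
      ← Real.rpow_add hR0, ← Real.rpow_mul hR0.le, ← Real.rpow_mul hR0.le, ← Real.rpow_add hR0,
      ← Real.rpow_add hR0, ← Real.rpow_add hR0]
    convert Real.rpow_zero R using 2
    rw [add_sub_cancel_right]
    field_simp
    linear_combination hA
  have key := volume_tubes_mul_rpow_le (m := m) J a x' (d := (m : ℝ) + 1 - α) (by linarith) (by linarith)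
    (by linarith) hc hR0 (by positivity) (by positivity) hρ hscale hsep x
  rwa [sub_sub_cancel] at key
end
end

section
/- Let n = 1, let 1/2 ≤ α ≤ 1 and let r > 0 with α ≤ 2r. Then the critical exponent for the α-dimensional sequential Schrödinger maximal estimate equals 1/4. Precisely: (a) for every s > 1/4 there is a constant C = C(α, r, s) such that for every sequence (t_k) ∈ ℓ^{r,∞} with ⟨(t_k)⟩ ≤ 1, every α-dimensional Borel measure μ on ℝ with constant C_μ ≤ 1, and every Schwartz function f : ℝ → ℂ, one has ∫_{B(0,1)} sup_k |e^{it_kΔ}f(x)|² dμ(x) ≤ C ‖f‖²_{H^s}; and (b) for every s < 1/4 and every C > 0 there exist a Schwartz function f, a sequence (t_k) ∈ ℓ^{r,∞} with ⟨(t_k)⟩ ≤ 1 and t_k → 0, and an α-dimensional Borel measure μ with constant C_μ ≤ 1 such that ∫_{B(0,1)} sup_k |e^{it_kΔ}f(x)|² dμ(x) > C ‖f‖²_{H^s}. -/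
open MeasureTheory Filter FourierTransform
open scoped ENNReal

noncomputable section

lemma norm_exp_two_pi_mul_I (u : ℝ) : ‖Complex.exp (2 * Real.pi * Complex.I * (u : ℂ))‖ = 1 := by
  rw [show (2 * Real.pi * Complex.I * (u : ℂ)) = ((2 * Real.pi * u : ℝ) : ℂ) * Complex.I by
    push_cast; ring, Complex.norm_exp_ofReal_mul_I]

/-- The Schrödinger kernel regularised by the Gaussian `exp (-l ξ²)` is bounded uniformly in
time. -/
lemma norm_gaussian_kernel_le {a l x : ℝ} (ha0 : 0 < a) (ha : a ≤ 1 / 4) (hl : 0 < l)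
    (hx : x ≠ 0) (t : ℝ) :
    ‖∫ ξ : ℝ, (Real.exp (-l * ξ ^ 2) : ℂ) *
        Complex.exp (2 * Real.pi * Complex.I * ((x * ξ + t * ξ ^ 2 : ℝ) : ℂ))‖
      ≤ √Real.pi * l ^ (-(1 / 2 - a)) * |x| ^ (-(2 * a)) := by
  set b : ℂ := ⟨l, -(2 * Real.pi * t)⟩ with hb
  have hbre : b.re = l := rfl
  have hb0 : b ≠ 0 := fun h => by rw [h] at hbre; simp at hbre; linarith
  have hnb : 0 < ‖b‖ := norm_pos_iff.2 hb0
  have hlb : l ≤ ‖b‖ := hbre ▸ Complex.re_le_norm b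
  have hbeq : b = l - 2 * Real.pi * t * Complex.I := by
    apply Complex.ext <;> simp [hb]
  have hG := fourierIntegral_gaussian (b := b) (by rw [hbre]; exact hl) (2 * Real.pi * x)
  have hint : ∫ ξ : ℝ, (Real.exp (-l * ξ ^ 2) : ℂ) *
        Complex.exp (2 * Real.pi * Complex.I * ((x * ξ + t * ξ ^ 2 : ℝ) : ℂ))
      = (Real.pi / b) ^ (1 / 2 : ℂ) * Complex.exp (-(2 * Real.pi * x) ^ 2 / (4 * b)) := by
    rw [← hG]
    refine integral_congr_ae (Eventually.of_forall fun ξ => ?_)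
    simp only
    rw [Complex.ofReal_exp, ← Complex.exp_add, ← Complex.exp_add, hbeq]
    congr 1
    push_cast
    ring
  rw [hint, norm_mul]
  have h1 : ‖((Real.pi : ℂ) / b) ^ (1 / 2 : ℂ)‖ = √Real.pi * ‖b‖ ^ (-(1 / 2) : ℝ) := by
    rw [show (1 / 2 : ℂ) = ((1 / 2 : ℝ) : ℂ) by push_cast; ring, Complex.norm_cpow_real, norm_div,
      Complex.norm_real, Real.norm_eq_abs, abs_of_pos Real.pi_pos,
      Real.div_rpow Real.pi_pos.le hnb.le, Real.sqrt_eq_rpow, Real.rpow_neg hnb.le]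
    rfl
  set u : ℝ := Real.pi ^ 2 * x ^ 2 * l / ‖b‖ ^ 2 with hu
  have hx2 : 0 < x ^ 2 := by positivity
  have hu0 : 0 < u := by positivity
  have h2 : ‖Complex.exp (-(2 * Real.pi * x) ^ 2 / (4 * b))‖ = Real.exp (-u) := by
    rw [Complex.norm_exp]
    congr 1
    have : (-(2 * Real.pi * x) ^ 2 / (4 * b) : ℂ) = ((-(Real.pi ^ 2 * x ^ 2) : ℝ) : ℂ) * b⁻¹ := by
      push_cast
      field_simp
      ring
    rw [this, Complex.re_ofReal_mul, Complex.inv_re, hbre, Complex.normSq_eq_norm_sq, hu]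
    ring
  have h3 : Real.exp (-u) ≤ u ^ (-a) := by
    rw [Real.exp_neg, Real.rpow_neg hu0.le]
    refine inv_anti₀ (by positivity) ?_
    calc u ^ a ≤ (Real.exp u) ^ a := by
          gcongr
          linarith [Real.add_one_le_exp u]
      _ = Real.exp (u * a) := (Real.exp_mul u a).symm
      _ ≤ Real.exp u := Real.exp_le_exp.2 (by nlinarith)
  have h4 : u ^ (-a) ≤ |x| ^ (-(2 * a)) * l ^ (-a) * ‖b‖ ^ (2 * a) := by
    have e : u = (Real.pi ^ 2 * (|x| ^ 2 * l)) / ‖b‖ ^ 2 := by rw [hu, sq_abs]; ring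
    have hxp : 0 < |x| := abs_pos.2 hx
    have hpi : (1 : ℝ) ≤ Real.pi ^ 2 := one_le_pow₀ (by linarith [Real.pi_gt_three])
    have hle : (|x| ^ 2 * l) / ‖b‖ ^ 2 ≤ u := by
      rw [e]
      exact div_le_div_of_nonneg_right (le_mul_of_one_le_left (by positivity) hpi) (by positivity)
    calc u ^ (-a) ≤ ((|x| ^ 2 * l) / ‖b‖ ^ 2) ^ (-a) :=
          Real.rpow_le_rpow_of_nonpos (by positivity) hle (by linarith)
      _ = _ := by
          rw [Real.div_rpow (by positivity) (by positivity), Real.mul_rpow (by positivity) hl.le,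
            ← Real.rpow_natCast, ← Real.rpow_natCast, ← Real.rpow_mul hxp.le,
            ← Real.rpow_mul hnb.le, div_eq_mul_inv, ← Real.rpow_neg hnb.le]
          push_cast
          congr 2 <;> ring_nf
  rw [h1, h2]
  calc √Real.pi * ‖b‖ ^ (-(1 / 2) : ℝ) * Real.exp (-u)
      ≤ √Real.pi * ‖b‖ ^ (-(1 / 2) : ℝ) * (|x| ^ (-(2 * a)) * l ^ (-a) * ‖b‖ ^ (2 * a)) := by
        gcongr
        exact h3.trans h4
    _ = √Real.pi * |x| ^ (-(2 * a)) * l ^ (-a) * (‖b‖ ^ (-(1 / 2) : ℝ) * ‖b‖ ^ (2 * a)) := by ring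
    _ = √Real.pi * |x| ^ (-(2 * a)) * l ^ (-a) * ‖b‖ ^ (-(1 / 2) + 2 * a) := by
        rw [← Real.rpow_add hnb]
    _ ≤ √Real.pi * |x| ^ (-(2 * a)) * l ^ (-a) * l ^ (-(1 / 2) + 2 * a) := by
        exact mul_le_mul_of_nonneg_left
          (Real.rpow_le_rpow_of_nonpos hl hlb (by linarith)) (by positivity)
    _ = √Real.pi * |x| ^ (-(2 * a)) * (l ^ (-a) * l ^ (-(1 / 2) + 2 * a)) := by ring
    _ = √Real.pi * |x| ^ (-(2 * a)) * l ^ (-(1 / 2 - a)) := by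
        rw [← Real.rpow_add hl]; congr 2; ring
    _ = _ := by ring

/-- Riesz potentials of order `β < α` of an `α`-dimensional measure are bounded. -/
lemma exists_lintegral_enorm_rpow_neg_le {α β : ℝ} (hβ : 0 < β) (hβα : β < α) :
    ∃ B : ℝ, 0 < B ∧ ∀ μ : Measure ℝ, IsAlphaDimensional1D α 1 μ →
      ∀ x ∈ Metric.ball (0 : ℝ) 1,
        ∫⁻ y in Metric.ball (0 : ℝ) 1, ‖x - y‖ₑ ^ (-β) ∂μ ≤ ENNReal.ofReal B := by
  have hq0 : (0 : ℝ) < (1 / 2) ^ (α - β) := by positivity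
  have hq1 : ((1 : ℝ) / 2) ^ (α - β) < 1 :=
    Real.rpow_lt_one (by norm_num) (by norm_num) (by linarith)
  have hsum : Summable fun n : ℕ => (4 : ℝ) ^ α * ((1 / 2) ^ (α - β)) ^ n :=
    (summable_geometric_of_lt_one hq0.le hq1).mul_left _
  refine ⟨∑' n : ℕ, (4 : ℝ) ^ α * ((1 / 2) ^ (α - β)) ^ n,
    hsum.tsum_pos (fun n => by positivity) 0 (by positivity), fun μ hμ x hx => ?_⟩
  have hpt : ∀ y ∈ Metric.ball (0 : ℝ) 1, ‖x - y‖ₑ ^ (-β) ≤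
      ∑' n : ℕ, (Metric.ball x (4 * (1 / 2) ^ n)).indicator
        (fun _ => ENNReal.ofReal (((1 / 2 : ℝ) ^ n) ^ (-β))) y := by
    intro y hy
    rcases eq_or_ne x y with rfl | hxy
    · refine le_of_le_of_eq le_top (Eq.symm ?_)
      rw [eq_top_iff, ← ENNReal.tsum_const_eq_top_of_ne_zero (α := ℕ) one_ne_zero]
      refine ENNReal.tsum_le_tsum fun n => ?_
      rw [Set.indicator_of_mem (Metric.mem_ball_self (by positivity)), ENNReal.one_le_ofReal]
      exact Real.one_le_rpow_of_pos_of_le_one_of_nonpos (by positivity)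
        (pow_le_one₀ (by norm_num) (by norm_num)) (by linarith)
    · have hpos : 0 < |x - y| := abs_pos.2 (sub_ne_zero.2 hxy)
      have hlt : |x - y| / 2 ≤ 1 := by
        rw [Real.ball_eq_Ioo] at hx hy
        have : |x - y| ≤ 2 := abs_le.2 ⟨by linarith [hx.1, hy.2], by linarith [hx.2, hy.1]⟩
        linarith
      obtain ⟨n, hn1, hn2⟩ := exists_nat_pow_near_of_lt_one (x := |x - y| / 2) (y := (1 / 2 : ℝ))
        (by positivity) hlt (by norm_num) (by norm_num)
      refine le_trans ?_ (ENNReal.le_tsum n)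
      have hn0 : (0 : ℝ) < (1 / 2) ^ n := by positivity
      rw [Set.indicator_of_mem]
      · rw [← ofReal_norm, Real.norm_eq_abs, ENNReal.ofReal_rpow_of_pos hpos]
        refine ENNReal.ofReal_le_ofReal
          (Real.rpow_le_rpow_of_nonpos hn0 ?_ (by linarith))
        rw [pow_succ] at hn1
        linarith
      · rw [Metric.mem_ball, dist_comm, Real.dist_eq]
        linarith
  calc ∫⁻ y in Metric.ball (0 : ℝ) 1, ‖x - y‖ₑ ^ (-β) ∂μ
      ≤ ∫⁻ y in Metric.ball (0 : ℝ) 1, ∑' n : ℕ, (Metric.ball x (4 * (1 / 2) ^ n)).indicator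
        (fun _ => ENNReal.ofReal (((1 / 2 : ℝ) ^ n) ^ (-β))) y ∂μ :=
        setLIntegral_mono' Metric.isOpen_ball.measurableSet hpt
    _ ≤ ∫⁻ y, ∑' n : ℕ, (Metric.ball x (4 * (1 / 2) ^ n)).indicator
        (fun _ => ENNReal.ofReal (((1 / 2 : ℝ) ^ n) ^ (-β))) y ∂μ := setLIntegral_le_lintegral _ _
    _ = ∑' n : ℕ, ENNReal.ofReal (((1 / 2 : ℝ) ^ n) ^ (-β)) *
          μ (Metric.ball x (4 * (1 / 2) ^ n)) := by
        rw [lintegral_tsum fun n =>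
          (measurable_const.indicator Metric.isOpen_ball.measurableSet).aemeasurable]
        simp_rw [lintegral_indicator_const Metric.isOpen_ball.measurableSet]
    _ ≤ ∑' n : ℕ, ENNReal.ofReal ((4 : ℝ) ^ α * ((1 / 2) ^ (α - β)) ^ n) := by
        refine ENNReal.tsum_le_tsum fun n => ?_
        refine (mul_le_mul_right (hμ x _ (by positivity)) _).trans_eq ?_
        rw [← ENNReal.ofReal_mul (by positivity)]
        congr 1
        rw [one_mul, Real.mul_rpow (by norm_num) (by positivity), ← Real.rpow_natCast,
          ← Real.rpow_natCast, ← Real.rpow_mul (by norm_num), ← Real.rpow_mul (by norm_num),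
          ← Real.rpow_mul (by norm_num), mul_left_comm, ← Real.rpow_add (by norm_num)]
        congr 2
        ring
    _ = _ := (ENNReal.ofReal_tsum_of_nonneg (fun n => by positivity) hsum).symm

/-- The adjoint of the linearised evolution `f ↦ (x ↦ e^{iτ(x)Δ}f(x))`, on the Fourier side. -/
def adjointEvolution (ν : Measure ℝ) (τ : ℝ → ℝ) (h : ℝ → ℂ) (ξ : ℝ) : ℂ :=
  ∫ x, h x * Complex.exp (2 * Real.pi * Complex.I * ((x * ξ + τ x * ξ ^ 2 : ℝ) : ℂ)) ∂ν

lemma stronglyMeasurable_adjointEvolution {ν : Measure ℝ} [IsFiniteMeasure ν] {τ : ℝ → ℝ}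
    (hτ : Measurable τ) {h : ℝ → ℂ} (hh : Measurable h) :
    StronglyMeasurable (adjointEvolution ν τ h) := by
  refine StronglyMeasurable.integral_prod_right (f := fun ξ x => h x *
    Complex.exp (2 * Real.pi * Complex.I * ((x * ξ + τ x * ξ ^ 2 : ℝ) : ℂ))) ?_
  exact Measurable.stronglyMeasurable (by fun_prop)

lemma lintegral_gaussian_mul_adjointEvolution_le {ν : Measure ℝ} [IsFiniteMeasure ν] {τ : ℝ → ℝ}
    (hτ : Measurable τ) {h : ℝ → ℂ} (hh : Measurable h) (hi : Integrable h ν) {l : ℝ}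
    (hl : 0 < l) :
    ∫⁻ ξ : ℝ, ENNReal.ofReal (Real.exp (-l * ξ ^ 2)) * ‖adjointEvolution ν τ h ξ‖ₑ ^ 2
      ≤ ∫⁻ p, ‖h p.1‖ₑ * ‖h p.2‖ₑ * ‖∫ ξ : ℝ, (Real.exp (-l * ξ ^ 2) : ℂ) *
        Complex.exp (2 * Real.pi * Complex.I *
          (((p.1 - p.2) * ξ + (τ p.1 - τ p.2) * ξ ^ 2 : ℝ) : ℂ))‖ₑ ∂(ν.prod ν) := by
  let F : ℝ → ℝ × ℝ → ℂ := fun ξ p => ((Real.exp (-l * ξ ^ 2) : ℂ) *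
    (h p.1 * star (h p.2))) * Complex.exp (2 * Real.pi * Complex.I *
          (((p.1 - p.2) * ξ + (τ p.1 - τ p.2) * ξ ^ 2 : ℝ) : ℂ))
  have hgauss : Integrable fun ξ : ℝ => (Real.exp (-l * ξ ^ 2) : ℂ) :=
    (integrable_exp_neg_mul_sq hl).ofReal
  have hstar : Integrable (fun x => star (h x)) ν :=
    hi.congr' (by fun_prop) (Eventually.of_forall fun x => (norm_star _).symm)
  have hFi : Integrable (Function.uncurry F) (volume.prod (ν.prod ν)) := by
    refine (hgauss.mul_prod (hi.mul_prod hstar)).mul_bdd (c := 1) ?_ ?_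
    · exact (Measurable.stronglyMeasurable (by fun_prop)).aestronglyMeasurable
    · exact Eventually.of_forall fun q => (norm_exp_two_pi_mul_I _).le
  have hsq : ∀ ξ : ℝ, ((Real.exp (-l * ξ ^ 2) * ‖adjointEvolution ν τ h ξ‖ ^ 2 : ℝ) : ℂ)
      = ∫ p, F ξ p ∂(ν.prod ν) := by
    intro ξ
    have hconj : star (adjointEvolution ν τ h ξ) = ∫ y, star (h y *
        Complex.exp (2 * Real.pi * Complex.I * ((y * ξ + τ y * ξ ^ 2 : ℝ) : ℂ))) ∂ν :=
      integral_conj.symm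
    have hmul : ((‖adjointEvolution ν τ h ξ‖ ^ 2 : ℝ) : ℂ)
        = adjointEvolution ν τ h ξ * star (adjointEvolution ν τ h ξ) := by
      rw [Complex.star_def, Complex.mul_conj, Complex.normSq_eq_norm_sq]
    rw [Complex.ofReal_mul, hmul, hconj, adjointEvolution, ← integral_prod_mul, ← integral_const_mul]
    refine integral_congr_ae (Eventually.of_forall fun p => ?_)
    simp only [F, star_mul', Complex.star_def, ← Complex.exp_conj]
    have e : Complex.exp (2 * Real.pi * Complex.I *
          (((p.1 - p.2) * ξ + (τ p.1 - τ p.2) * ξ ^ 2 : ℝ) : ℂ))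
        = Complex.exp (2 * Real.pi * Complex.I * ((p.1 * ξ + τ p.1 * ξ ^ 2 : ℝ) : ℂ)) *
          Complex.exp ((starRingEnd ℂ)
            (2 * Real.pi * Complex.I * ((p.2 * ξ + τ p.2 * ξ ^ 2 : ℝ) : ℂ))) := by
      rw [← Complex.exp_add]
      congr 1
      simp only [map_mul, Complex.conj_I, Complex.conj_ofReal, map_ofNat]
      push_cast
      ring
    rw [e]
    ring
  have hint : Integrable fun ξ : ℝ => Real.exp (-l * ξ ^ 2) * ‖adjointEvolution ν τ h ξ‖ ^ 2 := by
    have := hFi.integral_prod_left.re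
    refine this.congr (Eventually.of_forall fun ξ => ?_)
    simp only [Function.uncurry_apply_pair]
    rw [← hsq]
    simp only [RCLike.re_to_complex, Complex.ofReal_re]
  calc _ = ∫⁻ ξ : ℝ, ENNReal.ofReal (Real.exp (-l * ξ ^ 2) * ‖adjointEvolution ν τ h ξ‖ ^ 2) := by
        refine lintegral_congr fun ξ => ?_
        rw [ENNReal.ofReal_mul (Real.exp_pos _).le, ENNReal.ofReal_pow (norm_nonneg _), ofReal_norm]
    _ = ENNReal.ofReal (∫ ξ : ℝ, Real.exp (-l * ξ ^ 2) * ‖adjointEvolution ν τ h ξ‖ ^ 2) :=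
        (ofReal_integral_eq_lintegral_ofReal hint
          (Eventually.of_forall fun ξ => by positivity)).symm
    _ = ‖∫ ξ : ℝ, ∫ p, F ξ p ∂(ν.prod ν)‖ₑ := by
        simp_rw [← hsq]
        rw [integral_complex_ofReal, ← ofReal_norm, Complex.norm_real, Real.norm_eq_abs,
          abs_of_nonneg (integral_nonneg fun ξ => by positivity)]
    _ = ‖∫ p, (∫ ξ : ℝ, F ξ p) ∂(ν.prod ν)‖ₑ := by rw [integral_integral_swap hFi]
    _ ≤ ∫⁻ p, ‖∫ ξ : ℝ, F ξ p‖ₑ ∂(ν.prod ν) := enorm_integral_le_lintegral_enorm _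
    _ = _ := by
        refine lintegral_congr fun p => ?_
        have : ∀ ξ, F ξ p = (h p.1 * star (h p.2)) * ((Real.exp (-l * ξ ^ 2) : ℂ) *
            Complex.exp (2 * Real.pi * Complex.I *
              (((p.1 - p.2) * ξ + (τ p.1 - τ p.2) * ξ ^ 2 : ℝ) : ℂ))) := fun ξ => by
          simp only [F]; ring
        simp_rw [this]
        rw [integral_const_mul, enorm_mul, enorm_mul]
        congr 2
        rw [← ofReal_norm, norm_star, ofReal_norm]

lemma lintegral_prod_schur_le {ν : Measure ℝ} [IsFiniteMeasure ν] {β : ℝ} {B : ℝ≥0∞}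
    (hB : ∀ᵐ x ∂ν, ∫⁻ y, ‖x - y‖ₑ ^ (-β) ∂ν ≤ B) {h : ℝ → ℂ} (hh : Measurable h) :
    ∫⁻ p, ‖h p.1‖ₑ * ‖h p.2‖ₑ * ‖p.1 - p.2‖ₑ ^ (-β) ∂(ν.prod ν)
      ≤ 2 * B * ∫⁻ x, ‖h x‖ₑ ^ 2 ∂ν := by
  have hone : ∫⁻ p, ‖h p.1‖ₑ ^ 2 * ‖p.1 - p.2‖ₑ ^ (-β) ∂(ν.prod ν)
      ≤ B * ∫⁻ x, ‖h x‖ₑ ^ 2 ∂ν := by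
    rw [lintegral_prod _ (by fun_prop), ← lintegral_const_mul _ (by fun_prop)]
    refine lintegral_mono_ae ?_
    filter_upwards [hB] with x hx
    rw [lintegral_const_mul _ (by fun_prop), mul_comm]
    gcongr
  have htwo : ∫⁻ p, ‖h p.2‖ₑ ^ 2 * ‖p.1 - p.2‖ₑ ^ (-β) ∂(ν.prod ν)
      ≤ B * ∫⁻ x, ‖h x‖ₑ ^ 2 ∂ν := by
    rw [← lintegral_prod_swap]
    refine le_of_eq_of_le (lintegral_congr fun p => ?_) hone
    simp only [Prod.fst_swap, Prod.snd_swap]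
    rw [enorm_sub_rev]
  calc _ ≤ ∫⁻ p, ‖h p.1‖ₑ ^ 2 * ‖p.1 - p.2‖ₑ ^ (-β)
          + ‖h p.2‖ₑ ^ 2 * ‖p.1 - p.2‖ₑ ^ (-β) ∂(ν.prod ν) := by
        refine lintegral_mono fun p => ?_
        simp only
        rw [← add_mul]
        gcongr
        rcases le_total ‖h p.1‖ₑ ‖h p.2‖ₑ with hle | hle
        · refine le_trans ?_ le_add_self
          rw [sq]; gcongr
        · refine le_trans ?_ le_self_add
          rw [sq]; gcongr
    _ ≤ B * ∫⁻ x, ‖h x‖ₑ ^ 2 ∂ν + B * ∫⁻ x, ‖h x‖ₑ ^ 2 ∂ν := by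
        rw [lintegral_add_left (by fun_prop)]
        exact add_le_add hone htwo
    _ = _ := by ring

/-- The dual form of the maximal estimate. -/
lemma lintegral_adjointEvolution_le {a s : ℝ} (ha0 : 0 < a) (ha : a ≤ 1 / 4) (hs : 1 / 2 < s + a)
    {ν : Measure ℝ} [IsFiniteMeasure ν] {B : ℝ≥0∞}
    (hB : ∀ᵐ x ∂ν, ∫⁻ y, ‖x - y‖ₑ ^ (-(2 * a)) ∂ν ≤ B) {τ : ℝ → ℝ}
    (hτ : Measurable τ) {h : ℝ → ℂ} (hh : Measurable h) (hi : Integrable h ν) :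
    ∫⁻ ξ : ℝ, ENNReal.ofReal ((1 + ξ ^ 2) ^ (-s)) * ‖adjointEvolution ν τ h ξ‖ₑ ^ 2
      ≤ ENNReal.ofReal (√Real.pi * Real.Gamma (s + a - 1 / 2) / Real.Gamma s) *
        (2 * B * ∫⁻ x, ‖h x‖ₑ ^ 2 ∂ν) := by
  have hs0 : 0 < s := by linarith
  have hΓ : 0 < Real.Gamma s := Real.Gamma_pos_of_pos hs0
  have hHm : Measurable (adjointEvolution ν τ h) :=
    (stronglyMeasurable_adjointEvolution hτ hh).measurable
  have hgam : ∀ {σ c : ℝ}, 0 < σ → 0 < c →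
      ∫⁻ l in Set.Ioi (0 : ℝ), ENNReal.ofReal (l ^ (σ - 1) * Real.exp (-(c * l)))
        = ENNReal.ofReal ((1 / c) ^ σ * Real.Gamma σ) := by
    intro σ c hσ hc
    have hI := Real.integral_rpow_mul_exp_neg_mul_Ioi hσ hc
    rw [← hI]
    refine (ofReal_integral_eq_lintegral_ofReal ?_ ?_).symm
    · refine Integrable.of_integral_ne_zero ?_
      rw [hI]
      have := Real.Gamma_pos_of_pos hσ
      positivity
    · refine (ae_restrict_iff' measurableSet_Ioi).2 (Eventually.of_forall fun l hl => ?_)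
      have : (0 : ℝ) < l := hl
      simp only [Pi.zero_apply]
      positivity
  have hw : ∀ ξ : ℝ, ENNReal.ofReal ((1 + ξ ^ 2) ^ (-s))
      = ENNReal.ofReal (1 / Real.Gamma s) * ∫⁻ l in Set.Ioi (0 : ℝ),
        ENNReal.ofReal (l ^ (s - 1) * Real.exp (-((1 + ξ ^ 2) * l))) := by
    intro ξ
    have hp : 0 < 1 + ξ ^ 2 := by positivity
    rw [hgam hs0 hp, ← ENNReal.ofReal_mul (by positivity)]
    congr 1
    rw [one_div (1 + ξ ^ 2), Real.inv_rpow hp.le, Real.rpow_neg hp.le]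
    field_simp
  have hker : ∀ l ∈ Set.Ioi (0 : ℝ), ∫⁻ ξ : ℝ, ENNReal.ofReal (Real.exp (-l * ξ ^ 2)) *
      ‖adjointEvolution ν τ h ξ‖ₑ ^ 2 ≤ ENNReal.ofReal (√Real.pi * l ^ (-(1 / 2 - a))) *
        (2 * B * ∫⁻ x, ‖h x‖ₑ ^ 2 ∂ν) := by
    intro l hl
    have hl' : (0 : ℝ) < l := hl
    refine (lintegral_gaussian_mul_adjointEvolution_le hτ hh hi hl).trans ?_
    refine le_trans ?_ (mul_le_mul_right (lintegral_prod_schur_le hB hh) _)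
    rw [← lintegral_const_mul _ (by fun_prop)]
    refine lintegral_mono fun p => ?_
    simp only
    rw [mul_left_comm]
    gcongr
    rcases eq_or_ne (p.1 - p.2) 0 with h0 | h0
    · rw [h0, enorm_zero, ENNReal.zero_rpow_of_neg (by linarith), ENNReal.mul_top]
      · exact le_top
      · rw [Ne, ENNReal.ofReal_eq_zero, not_le]
        positivity
    · rw [← ofReal_norm, ← ofReal_norm (p.1 - p.2), Real.norm_eq_abs,
        ENNReal.ofReal_rpow_of_pos (abs_pos.2 h0), ← ENNReal.ofReal_mul (by positivity)]
      exact ENNReal.ofReal_le_ofReal (norm_gaussian_kernel_le ha0 ha hl h0 _)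
  generalize 2 * B * ∫⁻ x, ‖h x‖ₑ ^ 2 ∂ν = R at hker ⊢
  calc _ = ENNReal.ofReal (1 / Real.Gamma s) * ∫⁻ ξ : ℝ, ∫⁻ l in Set.Ioi (0 : ℝ),
        ENNReal.ofReal (l ^ (s - 1) * Real.exp (-((1 + ξ ^ 2) * l))) *
          ‖adjointEvolution ν τ h ξ‖ₑ ^ 2 := by
        rw [← lintegral_const_mul' _ _ ENNReal.ofReal_ne_top]
        refine lintegral_congr fun ξ => ?_
        rw [hw, lintegral_mul_const _ (by fun_prop), mul_assoc]
    _ = ENNReal.ofReal (1 / Real.Gamma s) * ∫⁻ l in Set.Ioi (0 : ℝ), ∫⁻ ξ : ℝ,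
        ENNReal.ofReal (l ^ (s - 1) * Real.exp (-((1 + ξ ^ 2) * l))) *
          ‖adjointEvolution ν τ h ξ‖ₑ ^ 2 := by
        rw [lintegral_lintegral_swap]
        exact Measurable.aemeasurable (by fun_prop)
    _ ≤ ENNReal.ofReal (1 / Real.Gamma s) * ∫⁻ l in Set.Ioi (0 : ℝ),
        ENNReal.ofReal √Real.pi *
          (ENNReal.ofReal (l ^ (s + a - 1 / 2 - 1) * Real.exp (-(1 * l))) * R) := by
        refine mul_le_mul_right ?_ _
        refine setLIntegral_mono' measurableSet_Ioi fun l hl => ?_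
        have hl' : (0 : ℝ) < l := hl
        calc _ = ENNReal.ofReal (l ^ (s - 1) * Real.exp (-l)) * ∫⁻ ξ : ℝ,
              ENNReal.ofReal (Real.exp (-l * ξ ^ 2)) * ‖adjointEvolution ν τ h ξ‖ₑ ^ 2 := by
              rw [← lintegral_const_mul' _ _ ENNReal.ofReal_ne_top]
              refine lintegral_congr fun ξ => ?_
              rw [← mul_assoc, ← ENNReal.ofReal_mul (by positivity), mul_assoc (l ^ (s - 1)),
                ← Real.exp_add]
              congr 4
              ring
          _ ≤ ENNReal.ofReal (l ^ (s - 1) * Real.exp (-l)) *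
              (ENNReal.ofReal (√Real.pi * l ^ (-(1 / 2 - a))) * R) := by
              gcongr
              exact hker l hl
          _ = _ := by
              rw [← mul_assoc, ← mul_assoc, ← ENNReal.ofReal_mul (by positivity),
                ← ENNReal.ofReal_mul (by positivity)]
              congr 2
              rw [show s + a - 1 / 2 - 1 = (s - 1) + (-(1 / 2 - a)) by ring, Real.rpow_add hl',
                one_mul]
              ring
    _ = _ := by
        rw [lintegral_const_mul' _ _ ENNReal.ofReal_ne_top, lintegral_mul_const _ (by fun_prop),
          hgam (by linarith) one_pos, ← mul_assoc, ← mul_assoc,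
          ← ENNReal.ofReal_mul (by positivity), ← ENNReal.ofReal_mul (by positivity)]
        congr 2
        rw [div_one, Real.one_rpow]
        ring

lemma continuous_schrodingerEvolution (f : SchwartzMap ℝ ℂ) :
    Continuous fun p : ℝ × ℝ => schrodingerEvolution1D f p.1 p.2 := by
  have hc : Continuous (𝓕 (f : ℝ → ℂ)) := by
    rw [← SchwartzMap.fourier_coe]; exact SchwartzMap.continuous _
  have hi : Integrable (𝓕 (f : ℝ → ℂ)) := by
    rw [← SchwartzMap.fourier_coe]; exact SchwartzMap.integrable _
  unfold schrodingerEvolution1D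
  refine continuous_of_dominated (bound := fun ξ => ‖𝓕 (f : ℝ → ℂ) ξ‖) ?_ ?_ hi.norm ?_
  · exact fun p => Continuous.aestronglyMeasurable (by fun_prop)
  · intro p
    refine Eventually.of_forall fun ξ => ?_
    rw [norm_mul, norm_exp_two_pi_mul_I, mul_one]
  · exact Eventually.of_forall fun ξ => by fun_prop

lemma norm_schrodingerEvolution_le (f : ℝ → ℂ) (t x : ℝ) :
    ‖schrodingerEvolution1D f t x‖ ≤ ∫ ξ, ‖𝓕 f ξ‖ := by
  refine (norm_integral_le_integral_norm _).trans_eq ?_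
  simp_rw [norm_mul, norm_exp_two_pi_mul_I, mul_one]

lemma integrable_sobolev (s : ℝ) (f : SchwartzMap ℝ ℂ) :
    Integrable fun ξ : ℝ => (1 + ‖ξ‖ ^ 2) ^ s * ‖𝓕 (f : ℝ → ℂ) ξ‖ ^ 2 := by
  obtain ⟨n, hn⟩ := exists_nat_ge s
  rw [← SchwartzMap.fourier_coe]
  set g : SchwartzMap ℝ ℂ := 𝓕 f with hg
  have h1 : Integrable fun ξ : ℝ => ‖ξ‖ ^ (2 * n) * ‖g ξ‖ := g.integrable_pow_mul volume (2 * n)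
  have h0 : Integrable fun ξ : ℝ => ‖g ξ‖ := g.integrable.norm
  have hc : Continuous g := g.continuous
  obtain ⟨K, hK⟩ : ∃ K, ∀ ξ, ‖g ξ‖ ≤ K := by
    obtain ⟨K, hK⟩ := g.decay 0 0
    exact ⟨K, fun ξ => by simpa using hK.2 ξ⟩
  have hK0 : 0 ≤ K := (norm_nonneg _).trans (hK 0)
  refine (((h0.add h1).const_mul (2 ^ n)).mul_const K).mono' ?_
    (Eventually.of_forall fun ξ => ?_)
  · refine Continuous.aestronglyMeasurable (Continuous.mul ?_ (by fun_prop))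
    exact Continuous.rpow_const (by fun_prop) fun ξ => Or.inl (by positivity)
  · rw [Real.norm_of_nonneg (by positivity)]
    have hw : (1 + ‖ξ‖ ^ 2) ^ s ≤ 2 ^ n * (1 + ‖ξ‖ ^ (2 * n)) := by
      calc (1 + ‖ξ‖ ^ 2) ^ s ≤ (1 + ‖ξ‖ ^ 2) ^ (n : ℝ) :=
            Real.rpow_le_rpow_of_exponent_le (by nlinarith [sq_nonneg ‖ξ‖]) hn
        _ = (1 + ‖ξ‖ ^ 2) ^ n := Real.rpow_natCast _ _
        _ ≤ 2 ^ (n - 1) * (1 ^ n + (‖ξ‖ ^ 2) ^ n) :=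
            add_pow_le zero_le_one (by positivity) n
        _ ≤ 2 ^ n * (1 ^ n + (‖ξ‖ ^ 2) ^ n) := by
            gcongr
            · norm_num
            · omega
        _ = _ := by rw [one_pow, pow_mul]
    calc _ ≤ (2 ^ n * (1 + ‖ξ‖ ^ (2 * n))) * (‖g ξ‖ * K) := by
          rw [sq ‖g ξ‖]
          gcongr
          exact hK ξ
      _ = _ := by simp only [Pi.add_apply]; ring

/-- The linearised maximal estimate. -/
lemma lintegral_linearised_le {a s : ℝ} (ha0 : 0 < a) (ha : a ≤ 1 / 4) (hs : 1 / 2 < s + a)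
    {ν : Measure ℝ} [IsFiniteMeasure ν] {B : ℝ≥0∞}
    (hB : ∀ᵐ x ∂ν, ∫⁻ y, ‖x - y‖ₑ ^ (-(2 * a)) ∂ν ≤ B) {τ : ℝ → ℝ}
    (hτ : Measurable τ) (f : SchwartzMap ℝ ℂ) :
    ∫⁻ x, ‖schrodingerEvolution1D f (τ x) x‖ₑ ^ 2 ∂ν
      ≤ ENNReal.ofReal (√Real.pi * Real.Gamma (s + a - 1 / 2) / Real.Gamma s) * (2 * B) *
        ENNReal.ofReal (sobolevNormSq1D s f) := by
  set u : ℝ → ℂ := fun x => schrodingerEvolution1D f (τ x) x with hu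
  have hum : Measurable u :=
    (continuous_schrodingerEvolution f).measurable.comp (hτ.prodMk measurable_id)
  have hstarm : Measurable fun x => star (u x) := by fun_prop
  have hi : Integrable (fun x => star (u x)) ν :=
    Integrable.of_bound hstarm.aestronglyMeasurable (∫ ξ, ‖𝓕 (f : ℝ → ℂ) ξ‖)
      (Eventually.of_forall fun x => by
        rw [norm_star]; exact norm_schrodingerEvolution_le _ _ _)
  have hFc : Continuous (𝓕 (f : ℝ → ℂ)) := by
    rw [← SchwartzMap.fourier_coe]; exact SchwartzMap.continuous _
  have hFi : Integrable (𝓕 (f : ℝ → ℂ)) := by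
    rw [← SchwartzMap.fourier_coe]; exact SchwartzMap.integrable _
  set H := adjointEvolution ν τ (fun x => star (u x)) with hH
  have hHm : Measurable H := (stronglyMeasurable_adjointEvolution hτ hstarm).measurable
  set A := ∫⁻ x, ‖u x‖ₑ ^ 2 ∂ν with hA
  have hAstar : ∫⁻ x, ‖star (u x)‖ₑ ^ 2 ∂ν = A := by
    refine lintegral_congr fun x => ?_
    rw [← ofReal_norm, norm_star, ofReal_norm]
  have hAtop : A ≠ ⊤ := by
    have hle : A ≤ ∫⁻ _, ENNReal.ofReal (∫ ξ, ‖𝓕 (f : ℝ → ℂ) ξ‖) ^ 2 ∂ν := by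
      refine lintegral_mono fun x => ?_
      rw [← ofReal_norm]
      gcongr
      exact norm_schrodingerEvolution_le _ _ _
    refine ne_top_of_le_ne_top ?_ hle
    rw [lintegral_const]
    exact ENNReal.mul_ne_top (ENNReal.pow_ne_top ENNReal.ofReal_ne_top) (measure_ne_top _ _)
  have hdual : ∫ x, star (u x) * u x ∂ν = ∫ ξ, 𝓕 (f : ℝ → ℂ) ξ * H ξ := by
    have hswap := integral_integral_swap (μ := ν) (ν := (volume : Measure ℝ))
      (f := fun x ξ => star (u x) * (𝓕 (f : ℝ → ℂ) ξ *
        Complex.exp (2 * Real.pi * Complex.I * ((x * ξ + τ x * ξ ^ 2 : ℝ) : ℂ)))) (by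
        simp only [Function.uncurry_def, ← mul_assoc (star _)]
        refine (hi.mul_prod hFi).mul_bdd (c := 1) ?_ ?_
        · exact (Measurable.stronglyMeasurable (by fun_prop)).aestronglyMeasurable
        · exact Eventually.of_forall fun q => (norm_exp_two_pi_mul_I _).le)
    simp_rw [integral_const_mul] at hswap
    refine Eq.trans hswap (integral_congr_ae (Eventually.of_forall fun ξ => ?_))
    simp only [hH, adjointEvolution]
    rw [← integral_const_mul]
    refine integral_congr_ae (Eventually.of_forall fun x => ?_)
    simp only
    ring
  have hAeq : A = ‖∫ x, star (u x) * u x ∂ν‖ₑ := by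
    have e : ∀ x, star (u x) * u x = ((‖u x‖ ^ 2 : ℝ) : ℂ) := fun x => by
      rw [Complex.star_def, mul_comm, Complex.mul_conj, Complex.normSq_eq_norm_sq]
    simp_rw [e]
    rw [integral_complex_ofReal, ← ofReal_norm, Complex.norm_real, Real.norm_eq_abs,
      abs_of_nonneg (integral_nonneg fun x => by positivity),
      ofReal_integral_eq_lintegral_ofReal _ (Eventually.of_forall fun x => by positivity)]
    · refine lintegral_congr fun x => ?_
      rw [ENNReal.ofReal_pow (norm_nonneg _), ofReal_norm]
    · refine Integrable.of_bound (Measurable.aestronglyMeasurable (by fun_prop))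
        ((∫ ξ, ‖𝓕 (f : ℝ → ℂ) ξ‖) ^ 2) (Eventually.of_forall fun x => ?_)
      rw [Real.norm_of_nonneg (by positivity)]
      gcongr
      exact norm_schrodingerEvolution_le _ _ _
  have hCS : A ^ 2 ≤ ENNReal.ofReal (sobolevNormSq1D s f) *
      ∫⁻ ξ : ℝ, ENNReal.ofReal ((1 + ξ ^ 2) ^ (-s)) * ‖H ξ‖ₑ ^ 2 := by
    have h1 : A ≤ ∫⁻ ξ : ℝ, (ENNReal.ofReal ((1 + ξ ^ 2) ^ (s / 2)) * ‖𝓕 (f : ℝ → ℂ) ξ‖ₑ) *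
        (ENNReal.ofReal ((1 + ξ ^ 2) ^ (-(s / 2))) * ‖H ξ‖ₑ) := by
      rw [hAeq, hdual]
      refine (enorm_integral_le_lintegral_enorm _).trans_eq (lintegral_congr fun ξ => ?_)
      have hp : (0 : ℝ) < 1 + ξ ^ 2 := by positivity
      rw [enorm_mul, mul_mul_mul_comm, ← ENNReal.ofReal_mul (by positivity), ← Real.rpow_add hp]
      simp
    have h2 := ENNReal.lintegral_mul_le_Lp_mul_Lq volume Real.HolderConjugate.two_two
      (f := fun ξ : ℝ => ENNReal.ofReal ((1 + ξ ^ 2) ^ (s / 2)) * ‖𝓕 (f : ℝ → ℂ) ξ‖ₑ)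
      (g := fun ξ : ℝ => ENNReal.ofReal ((1 + ξ ^ 2) ^ (-(s / 2))) * ‖H ξ‖ₑ)
      (Measurable.aemeasurable (by fun_prop)) (Measurable.aemeasurable (by fun_prop))
    have hsq : ∀ c : ℝ, ∀ ξ : ℝ, ∀ z : ℂ, (ENNReal.ofReal ((1 + ξ ^ 2) ^ (c / 2)) * ‖z‖ₑ) ^ (2 : ℝ)
        = ENNReal.ofReal ((1 + ξ ^ 2) ^ c) * ‖z‖ₑ ^ 2 := by
      intro c ξ z
      have hp : (0 : ℝ) < 1 + ξ ^ 2 := by positivity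
      rw [ENNReal.rpow_two, mul_pow, ← ENNReal.ofReal_pow (by positivity), ← Real.rpow_natCast,
        ← Real.rpow_mul hp.le]
      congr 3
      push_cast; ring
    have h3 : ∫⁻ ξ : ℝ, ENNReal.ofReal ((1 + ξ ^ 2) ^ s) * ‖𝓕 (f : ℝ → ℂ) ξ‖ₑ ^ 2
        = ENNReal.ofReal (sobolevNormSq1D s f) := by
      rw [sobolevNormSq1D, ofReal_integral_eq_lintegral_ofReal (integrable_sobolev s f)
        (Eventually.of_forall fun ξ => by positivity)]
      refine lintegral_congr fun ξ => ?_
      rw [ENNReal.ofReal_mul (by positivity), ENNReal.ofReal_pow (norm_nonneg _), ofReal_norm,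
        Real.norm_eq_abs, sq_abs]
    simp only [← neg_div] at h1 h2
    simp_rw [hsq] at h2
    rw [h3] at h2
    have h4 := h1.trans h2
    refine (pow_le_pow_left' h4 2).trans_eq ?_
    rw [mul_pow, ← ENNReal.rpow_natCast, ← ENNReal.rpow_natCast, ← ENNReal.rpow_mul,
      ← ENNReal.rpow_mul]
    norm_num
  have hadj := lintegral_adjointEvolution_le ha0 ha hs hB hτ hstarm hi
  rw [hAstar] at hadj
  have hfin := hCS.trans (mul_le_mul_right hadj _)
  rcases eq_or_ne A 0 with h0 | h0
  · rw [h0]; exact zero_le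
  · refine (ENNReal.mul_le_mul_iff_left h0 hAtop).1 ?_
    rw [← sq]
    refine hfin.trans_eq ?_
    ring

/-- A finite supremum of measurable evolutions is attained at a measurable choice of times. -/
lemma exists_measurable_time_selection (f : SchwartzMap ℝ ℂ) (t : ℕ → ℝ) (n : ℕ) :
    ∃ τ : ℝ → ℝ, Measurable τ ∧ ∀ x, ∀ k ≤ n,
      ‖schrodingerEvolution1D f (t k) x‖ ≤ ‖schrodingerEvolution1D f (τ x) x‖ := by
  have hc := continuous_schrodingerEvolution f
  induction n with
  | zero =>
    refine ⟨fun _ => t 0, measurable_const, fun x k hk => ?_⟩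
    rw [Nat.le_zero.1 hk]
  | succ n ih =>
    obtain ⟨τ, hτ, hle⟩ := ih
    classical
    have hS : MeasurableSet {x | ‖schrodingerEvolution1D f (τ x) x‖
        ≤ ‖schrodingerEvolution1D f (t (n + 1)) x‖} :=
      measurableSet_le
        (hc.measurable.comp (hτ.prodMk measurable_id)).norm
        (hc.measurable.comp (measurable_const.prodMk measurable_id)).norm
    refine ⟨fun x => if ‖schrodingerEvolution1D f (τ x) x‖
        ≤ ‖schrodingerEvolution1D f (t (n + 1)) x‖ then t (n + 1) else τ x,
      Measurable.ite hS measurable_const hτ, fun x k hk => ?_⟩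
    beta_reduce
    rcases Nat.le_succ_iff.1 hk with hk | rfl
    · have := hle x k hk
      split_ifs with hx
      · exact this.trans hx
      · exact this
    · split_ifs with hx
      · exact le_rfl
      · exact (not_le.1 hx).le

/-- The maximal estimate above regularity `1 / 4`, for arbitrary sequences of times. -/
lemma exists_maximalIntegral_le {α s : ℝ} (hα : 1 / 2 ≤ α) (hs : 1 / 4 < s) :
    ∃ C : ℝ, 0 < C ∧ ∀ (t : ℕ → ℝ) (μ : Measure ℝ), IsAlphaDimensional1D α 1 μ →
      ∀ f : SchwartzMap ℝ ℂ,
        maximalIntegral1D μ t f ≤ ENNReal.ofReal (C * sobolevNormSq1D s f) := by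
  obtain ⟨a, ha1, ha2⟩ := exists_between (max_lt (by norm_num : (0 : ℝ) < 1 / 4)
    (by linarith : 1 / 2 - s < 1 / 4))
  have ha0 : 0 < a := (le_max_left _ _).trans_lt ha1
  have hsa : 1 / 2 < s + a := by linarith [(le_max_right 0 (1 / 2 - s)).trans_lt ha1]
  obtain ⟨B, hB0, hB⟩ := exists_lintegral_enorm_rpow_neg_le (α := α) (β := 2 * a) (by linarith)
    (by linarith)
  have hΓ : 0 < Real.Gamma s := Real.Gamma_pos_of_pos (by linarith)
  have hΓ' : 0 < Real.Gamma (s + a - 1 / 2) := Real.Gamma_pos_of_pos (by linarith)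
  refine ⟨√Real.pi * Real.Gamma (s + a - 1 / 2) / Real.Gamma s * (2 * B), by positivity,
    fun t μ hμ f => ?_⟩
  set ν := μ.restrict (Metric.ball (0 : ℝ) 1) with hν
  have : IsFiniteMeasure ν := ⟨by
    rw [hν, Measure.restrict_apply_univ]
    exact (hμ 0 1 one_pos).trans_lt ENNReal.ofReal_lt_top⟩
  have hBν : ∀ᵐ x ∂ν, ∫⁻ y, ‖x - y‖ₑ ^ (-(2 * a)) ∂ν ≤ ENNReal.ofReal B :=
    (ae_restrict_iff' Metric.isOpen_ball.measurableSet).2 (Eventually.of_forall (hB μ hμ))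
  let F : ℕ → ℝ → ℝ≥0∞ := fun k x => ENNReal.ofReal (‖schrodingerEvolution1D f (t k) x‖ ^ 2)
  have hFm : ∀ k, Measurable (F k) := fun k =>
    ENNReal.measurable_ofReal.comp (((continuous_schrodingerEvolution f).measurable.comp
      (measurable_const.prodMk measurable_id)).norm.pow_const 2)
  have hsup : maximalIntegral1D μ t f = ⨆ n, ∫⁻ x, ⨆ k, ⨆ _ : k ≤ n, F k x ∂ν := by
    rw [← lintegral_iSup]
    · refine lintegral_congr fun x => le_antisymm ?_ ?_
      · exact iSup_le fun k => le_iSup_of_le k (le_iSup₂_of_le k le_rfl le_rfl)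
      · exact iSup_le fun n => iSup₂_le fun k _ => le_iSup (fun k => F k x) k
    · exact fun n => Measurable.iSup fun k => Measurable.iSup fun _ => hFm k
    · intro m n hmn x
      exact iSup₂_le fun k hk => le_iSup₂_of_le k (hk.trans hmn) le_rfl
  rw [hsup]
  refine iSup_le fun n => ?_
  obtain ⟨τ, hτ, hle⟩ := exists_measurable_time_selection f t n
  calc _ ≤ ∫⁻ x, ‖schrodingerEvolution1D f (τ x) x‖ₑ ^ 2 ∂ν := by
        refine lintegral_mono fun x => iSup₂_le fun k hk => ?_
        simp only [F]
        rw [ENNReal.ofReal_pow (norm_nonneg _), ← ofReal_norm]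
        gcongr
        exact hle x k hk
    _ ≤ _ := lintegral_linearised_le ha0 ha2.le hsa hBν hτ f
    _ = _ := by
        have h2B : 2 * ENNReal.ofReal B = ENNReal.ofReal (2 * B) := by
          rw [ENNReal.ofReal_mul zero_le_two, ENNReal.ofReal_ofNat]
        rw [h2B, ← ENNReal.ofReal_mul (by positivity), ← ENNReal.ofReal_mul (by positivity)]

/-- A real-valued bump against a phase that stays within `π / 3` of a constant has integral at
least half the integral of the bump. -/
lemma half_integral_le_norm_integral_mul_exp {g θ : ℝ → ℝ} (hg0 : ∀ ξ, 0 ≤ g ξ)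
    (hg : Integrable g) (hθ : Continuous θ) (θ₀ : ℝ)
    (h : ∀ ξ, g ξ ≠ 0 → |θ ξ - θ₀| ≤ Real.pi / 3) :
    (∫ ξ, g ξ) / 2 ≤ ‖∫ ξ, (g ξ : ℂ) * Complex.exp (Complex.I * (θ ξ : ℂ))‖ := by
  have hcos : (∫ ξ, g ξ) / 2 ≤ ∫ ξ, g ξ * Real.cos (θ ξ - θ₀) := by
    rw [← integral_div]
    refine integral_mono (hg.div_const 2) ?_ fun ξ => ?_
    · exact hg.mul_bdd (c := 1) (by fun_prop)
        (Eventually.of_forall fun ξ => by simpa using Real.abs_cos_le_one _)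
    · by_cases h0 : g ξ = 0
      · simp [h0]
      · have h1 := h ξ h0
        have h2 : Real.cos (Real.pi / 3) ≤ Real.cos |θ ξ - θ₀| :=
          Real.cos_le_cos_of_nonneg_of_le_pi (abs_nonneg _) (by linarith [Real.pi_pos]) h1
        rw [Real.cos_abs, Real.cos_pi_div_three] at h2
        have := mul_le_mul_of_nonneg_left h2 (hg0 ξ)
        simp only; linarith
  refine hcos.trans ?_
  have hint : Integrable fun ξ => (g ξ : ℂ) * Complex.exp (Complex.I * (θ ξ - θ₀ : ℝ)) := by
    refine (hg.ofReal (𝕜 := ℂ)).mul_bdd (c := 1) (by fun_prop) (Eventually.of_forall fun ξ => ?_)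
    rw [mul_comm, Complex.norm_exp_ofReal_mul_I]
  have hre : ∫ ξ, g ξ * Real.cos (θ ξ - θ₀)
      = (∫ ξ, (g ξ : ℂ) * Complex.exp (Complex.I * (θ ξ - θ₀ : ℝ))).re := by
    rw [← Complex.reCLM_apply, ← Complex.reCLM.integral_comp_comm hint]
    refine integral_congr_ae (Eventually.of_forall fun ξ => ?_)
    simp only [Complex.reCLM_apply, Complex.re_ofReal_mul]
    rw [mul_comm Complex.I, Complex.exp_ofReal_mul_I_re]
  rw [hre]
  refine (Complex.re_le_norm _).trans_eq ?_
  have hfac : ∀ ξ, (g ξ : ℂ) * Complex.exp (Complex.I * (θ ξ - θ₀ : ℝ))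
      = ((g ξ : ℂ) * Complex.exp (Complex.I * (θ ξ : ℂ))) * Complex.exp ((-θ₀ : ℝ) * Complex.I) := by
    intro ξ
    rw [mul_assoc, ← Complex.exp_add]
    congr 2
    push_cast; ring
  simp_rw [hfac]
  rw [integral_mul_const, norm_mul, Complex.norm_exp_ofReal_mul_I, mul_one]

/-- The wave packet at frequency `D ^ 2` with frequency width `D / 16`. -/
lemma exists_wavePacket {D : ℝ} (hD : 1 ≤ D) : ∃ f : SchwartzMap ℝ ℂ,
    (∀ s : ℝ, s ≤ 1 / 4 → sobolevNormSq1D s f ≤ D * D ^ (4 * max s 0)) ∧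
    ∀ t x : ℝ, |x + 2 * t * D ^ 2| ≤ 1 / D → |t| ≤ 1 / (2 * D ^ 2) →
      D / 64 ≤ ‖schrodingerEvolution1D f t x‖ := by
  have hD0 : 0 < D := by linarith
  let φ : ContDiffBump (D ^ 2) := ⟨D / 32, D / 16, by positivity, by linarith⟩
  have hsupp : ∀ ξ, φ ξ ≠ 0 → |ξ - D ^ 2| ≤ D / 16 := by
    intro ξ hξ
    by_contra! hlt
    exact hξ (φ.zero_of_le_dist (by rw [Real.dist_eq]; exact hlt.le))
  have hcs : HasCompactSupport fun ξ => ((φ ξ : ℝ) : ℂ) :=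
    φ.hasCompactSupport.comp_left (g := fun y : ℝ => (y : ℂ)) (by simp)
  have hsm : ContDiff ℝ (⊤ : ℕ∞) fun ξ => ((φ ξ : ℝ) : ℂ) :=
    Complex.ofRealCLM.contDiff.comp φ.contDiff
  let g : SchwartzMap ℝ ℂ := hcs.toSchwartzMap hsm
  let f : SchwartzMap ℝ ℂ := 𝓕⁻ g
  have hf : ∀ ξ, 𝓕 (f : ℝ → ℂ) ξ = (φ ξ : ℝ) := by
    intro ξ
    rw [← SchwartzMap.fourier_coe, FourierTransform.fourier_fourierInv_eq]
    rfl
  have hφi : Integrable (fun ξ => φ ξ) :=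
    φ.continuous.integrable_of_hasCompactSupport φ.hasCompactSupport
  refine ⟨f, fun s hs => ?_, fun t x hx ht => ?_⟩
  · unfold sobolevNormSq1D
    simp_rw [hf]
    have hB : ∀ ξ : ℝ, (1 + ‖ξ‖ ^ 2) ^ s * ‖((φ ξ : ℝ) : ℂ)‖ ^ 2
        ≤ (Set.Icc (D ^ 2 - D / 16) (D ^ 2 + D / 16)).indicator
          (fun _ => 5 * D ^ (4 * max s 0)) ξ := by
      intro ξ
      by_cases h0 : φ ξ = 0
      · simp only [h0]
        norm_num
        exact Set.indicator_nonneg (fun _ _ => by positivity) _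
      have hξ := abs_le.1 (hsupp ξ h0)
      rw [Set.indicator_of_mem (Set.mem_Icc.2 ⟨by linarith, by linarith⟩)]
      have h1 : (1 + ‖ξ‖ ^ 2) ^ s ≤ 5 * D ^ (4 * max s 0) := by
        have hs1 : max s 0 ≤ 1 := max_le (by linarith) (by norm_num)
        have hm : 0 ≤ max s 0 := le_max_right _ _
        have hDD : D ≤ D ^ 2 := by nlinarith
        have hξ2 : ξ ^ 2 ≤ (2 * D ^ 2) ^ 2 := by
          apply sq_le_sq'
          · nlinarith
          · nlinarith
        calc (1 + ‖ξ‖ ^ 2) ^ s ≤ (1 + ‖ξ‖ ^ 2) ^ (max s 0) :=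
              Real.rpow_le_rpow_of_exponent_le (by nlinarith [sq_nonneg ‖ξ‖]) (le_max_left _ _)
          _ ≤ (5 * D ^ 4) ^ (max s 0) := by
              apply Real.rpow_le_rpow (by positivity) _ hm
              rw [Real.norm_eq_abs, sq_abs]
              have : (1 : ℝ) ≤ D ^ 4 := one_le_pow₀ hD
              nlinarith
          _ = 5 ^ (max s 0) * D ^ (4 * max s 0) := by
              rw [Real.mul_rpow (by norm_num) (by positivity), Real.rpow_mul hD0.le]
              norm_cast
          _ ≤ 5 * D ^ (4 * max s 0) := by
              gcongr
              calc (5 : ℝ) ^ (max s 0) ≤ 5 ^ (1 : ℝ) :=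
                    Real.rpow_le_rpow_of_exponent_le (by norm_num) hs1
                _ = 5 := by norm_num
      have h2 : ‖((φ ξ : ℝ) : ℂ)‖ ^ 2 ≤ 1 := by
        rw [Complex.norm_real, Real.norm_eq_abs, abs_of_nonneg φ.nonneg]
        exact pow_le_one₀ φ.nonneg φ.le_one
      calc _ ≤ (5 * D ^ (4 * max s 0)) * 1 := by gcongr
        _ = _ := mul_one _
    calc _ ≤ ∫ ξ, (Set.Icc (D ^ 2 - D / 16) (D ^ 2 + D / 16)).indicator
          (fun _ => 5 * D ^ (4 * max s 0)) ξ := by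
          refine integral_mono_of_nonneg (Eventually.of_forall fun ξ => by positivity) ?_
            (Eventually.of_forall hB)
          exact (integrable_indicator_iff measurableSet_Icc).2
            (integrableOn_const (by simp) enorm_ne_top)
      _ = D / 8 * (5 * D ^ (4 * max s 0)) := by
          rw [integral_indicator measurableSet_Icc, setIntegral_const, smul_eq_mul]
          congr 1
          rw [Measure.real, Real.volume_Icc, ENNReal.toReal_ofReal (by linarith)]
          ring
      _ ≤ _ := by
          have : 0 ≤ D * D ^ (4 * max s 0) := by positivity
          linarith
  · unfold schrodingerEvolution1D
    simp_rw [hf]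
    have key := half_integral_le_norm_integral_mul_exp (g := fun ξ => φ ξ)
      (θ := fun ξ => 2 * Real.pi * (x * ξ + t * ξ ^ 2)) (fun ξ => φ.nonneg) hφi
      (by fun_prop) (2 * Real.pi * (x * D ^ 2 + t * (D ^ 2) ^ 2)) ?_
    · have hlow : D / 32 ≤ ∫ ξ, φ ξ := by
        calc D / 32 ≤ ∫ ξ, (Set.Icc (D ^ 2 - D / 32) (D ^ 2 + D / 32)).indicator
              (fun _ => (1 : ℝ)) ξ := by
              rw [integral_indicator measurableSet_Icc, setIntegral_const, smul_eq_mul,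
                Measure.real, Real.volume_Icc, ENNReal.toReal_ofReal (by linarith)]
              linarith
          _ ≤ _ := by
              refine integral_mono ?_ hφi fun ξ => ?_
              · exact (integrable_indicator_iff measurableSet_Icc).2
                  (integrableOn_const (by simp) enorm_ne_top)
              · by_cases hξ : ξ ∈ Set.Icc (D ^ 2 - D / 32) (D ^ 2 + D / 32)
                · rw [Set.indicator_of_mem hξ]
                  refine (φ.one_of_mem_closedBall ?_).ge
                  rw [Real.closedBall_eq_Icc]
                  exact hξ
                · rw [Set.indicator_of_notMem hξ]
                  exact φ.nonneg
      refine le_trans (by linarith) (key.trans_eq ?_)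
      congr 1
      refine integral_congr_ae (Eventually.of_forall fun ξ => ?_)
      simp only
      congr 2
      push_cast
      ring
    · intro ξ hξ
      have h1 := hsupp ξ hξ
      have e : 2 * Real.pi * (x * ξ + t * ξ ^ 2)
          - 2 * Real.pi * (x * D ^ 2 + t * (D ^ 2) ^ 2)
          = 2 * Real.pi * ((x + 2 * t * D ^ 2) * (ξ - D ^ 2) + t * (ξ - D ^ 2) ^ 2) := by ring
      have h2 : |(x + 2 * t * D ^ 2) * (ξ - D ^ 2)| ≤ 1 / 16 := by
        rw [abs_mul]
        calc _ ≤ 1 / D * (D / 16) := by gcongr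
          _ = 1 / 16 := by field_simp
      have h3 : |t * (ξ - D ^ 2) ^ 2| ≤ 1 / 16 := by
        rw [abs_mul, abs_pow]
        calc _ ≤ 1 / (2 * D ^ 2) * (D / 16) ^ 2 := by gcongr
          _ = 1 / 512 := by field_simp; norm_num
          _ ≤ _ := by norm_num
      rw [e, abs_mul, abs_of_pos (by positivity)]
      have h4 := (abs_add_le _ _).trans (add_le_add h2 h3)
      calc _ ≤ 2 * Real.pi * (1 / 16 + 1 / 16) := by gcongr
        _ ≤ _ := by linarith [Real.pi_pos]

/-- An interval of length `b - a` holds at most `M (b - a) + 1` points of the grid `M⁻¹ ℤ`. -/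
lemma card_grid_filter_le {M : ℕ} (hM : 0 < M) {a b : ℝ} (hab : a ≤ b) :
    (((Finset.range M).filter fun j : ℕ => a < j / M ∧ (j : ℝ) / M < b).card : ℝ)
      ≤ M * (b - a) + 1 := by
  have hM' : (0 : ℝ) < M := by exact_mod_cast hM
  have hcard : ((Finset.range M).filter fun j : ℕ => a < j / M ∧ (j : ℝ) / M < b).card
      ≤ (Finset.Ioo ⌊M * a⌋ ⌈M * b⌉).card := by
    refine Finset.card_le_card_of_injOn (fun j : ℕ => (j : ℤ)) ?_ Nat.cast_injective.injOn
    intro j hj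
    simp only [Finset.coe_filter, Finset.mem_range, Set.mem_ofPred_eq, lt_div_iff₀ hM',
      div_lt_iff₀ hM'] at hj
    rw [Finset.mem_coe, Finset.mem_Ioo, Int.floor_lt, Int.lt_ceil]
    push_cast
    constructor <;> linarith [hj.2.1, hj.2.2]
  rw [Int.card_Ioo] at hcard
  have hle : ⌊M * a⌋ ≤ ⌈M * b⌉ :=
    (Int.floor_le_ceil _).trans (Int.ceil_mono (by gcongr))
  have h1 : ((⌈M * b⌉ - ⌊M * a⌋ - 1).toNat : ℝ) ≤ M * (b - a) + 1 := by
    have h2 : (((⌈M * b⌉ - ⌊M * a⌋ - 1).toNat : ℤ) : ℝ)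
        = ((max (⌈M * b⌉ - ⌊M * a⌋ - 1) 0 : ℤ) : ℝ) := by rw [Int.toNat_eq_max]
    have h3 := Int.ceil_lt_add_one (M * b)
    have h4 := Int.lt_floor_add_one (M * a)
    rw [← Int.cast_natCast, h2]
    push_cast
    refine max_le (by linarith) ?_
    have : 0 ≤ M * (b - a) := mul_nonneg hM'.le (by linarith)
    linarith
  exact le_trans (by exact_mod_cast hcard) h1

/-- The normalised Lebesgue measure on `M` equally spaced intervals of length `δ` in `[0, 1)`. -/
def gridMeasure (α δ : ℝ) (M : ℕ) : Measure ℝ :=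
  ∑ j ∈ Finset.range M,
    ENNReal.ofReal (δ ^ (α - 1) / 8) • volume.restrict (Set.Ico ((j : ℝ) / M) (j / M + δ))

lemma isAlphaDimensional_gridMeasure {α δ : ℝ} {M : ℕ} (hα0 : 0 < α) (hα : α ≤ 1)
    (hM : 0 < M) (hδ0 : 0 < δ) (hδ1 : δ ≤ 1) (hδM : δ ^ α * M = 1) :
    IsAlphaDimensional1D α 1 (gridMeasure α δ M) := by
  intro x ρ hρ
  have hM' : (0 : ℝ) < M := by exact_mod_cast hM
  have hδα : 0 < δ ^ (α - 1) := Real.rpow_pos_of_pos hδ0 _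
  have hmul : δ ^ (α - 1) * δ = δ ^ α := by
    rw [← Real.rpow_add_one hδ0.ne']; congr 1; ring
  have hδδ : δ ≤ δ ^ α := by
    simpa using Real.rpow_le_rpow_of_exponent_ge hδ0 hδ1 hα
  set S := (Finset.range M).filter fun j : ℕ => x - ρ - δ < j / M ∧ (j : ℝ) / M < x + ρ with hS
  have hcard : (S.card : ℝ) ≤ M * (2 * ρ + δ) + 1 := by
    have := card_grid_filter_le hM (a := x - ρ - δ) (b := x + ρ) (by linarith)
    refine this.trans_eq ?_
    ring
  have hcardM : (S.card : ℝ) ≤ M := by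
    have := Finset.card_filter_le (Finset.range M)
      fun j : ℕ => x - ρ - δ < j / M ∧ (j : ℝ) / M < x + ρ
    rw [Finset.card_range] at this
    exact_mod_cast this
  have hmeas : gridMeasure α δ M (Metric.ball x ρ)
      ≤ ENNReal.ofReal (S.card * (δ ^ (α - 1) / 8 * min (2 * ρ) δ)) := by
    rw [gridMeasure, Measure.finsetSum_apply]
    calc _ ≤ ∑ j ∈ Finset.range M, if x - ρ - δ < j / M ∧ (j : ℝ) / M < x + ρ then
            ENNReal.ofReal (δ ^ (α - 1) / 8 * min (2 * ρ) δ) else 0 := by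
          refine Finset.sum_le_sum fun j _ => ?_
          rw [Measure.smul_apply, Measure.restrict_apply Metric.isOpen_ball.measurableSet,
            smul_eq_mul]
          split_ifs with hj
          · rw [ENNReal.ofReal_mul (by positivity)]
            gcongr
            rw [ENNReal.ofReal_min]
            refine le_min ?_ ?_
            · exact (measure_mono Set.inter_subset_left).trans_eq (Real.volume_ball _ _)
            · refine (measure_mono Set.inter_subset_right).trans_eq ?_
              rw [Real.volume_Ico]; congr 1; ring
          · have : Metric.ball x ρ ∩ Set.Ico ((j : ℝ) / M) (j / M + δ) = ∅ := by
              rw [Set.eq_empty_iff_forall_notMem]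
              rintro y ⟨hy1, hy2, hy3⟩
              rw [Real.ball_eq_Ioo] at hy1
              exact hj ⟨by linarith [hy1.1], by linarith [hy1.2]⟩
            rw [this]; simp
      _ = _ := by
          rw [← Finset.sum_filter, Finset.sum_const, nsmul_eq_mul,
            ENNReal.ofReal_mul (Nat.cast_nonneg _), ENNReal.ofReal_natCast]
  refine hmeas.trans (ENNReal.ofReal_le_ofReal ?_)
  rw [one_mul]
  rcases le_total ρ δ with h | h
  · have h1 : (S.card : ℝ) ≤ 4 := by
      have : M * (2 * ρ + δ) ≤ 3 * (δ ^ α * M) := by nlinarith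
      linarith
    have h2 : δ ^ (α - 1) * ρ ≤ ρ ^ α := by
      have h3 : δ ^ (α - 1) ≤ ρ ^ (α - 1) :=
        Real.rpow_le_rpow_of_nonpos hρ h (by linarith)
      calc δ ^ (α - 1) * ρ ≤ ρ ^ (α - 1) * ρ := by gcongr
        _ = ρ ^ α := by rw [← Real.rpow_add_one hρ.ne']; congr 1; ring
    calc _ ≤ 4 * (δ ^ (α - 1) / 8 * (2 * ρ)) := by
          gcongr
          exact min_le_left _ _
      _ = δ ^ (α - 1) * ρ := by ring
      _ ≤ _ := h2
  · have h1 : (S.card : ℝ) * (δ ^ (α - 1) / 8 * min (2 * ρ) δ) ≤ S.card * δ ^ α / 8 := by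
      calc _ ≤ (S.card : ℝ) * (δ ^ (α - 1) / 8 * δ) := by
            gcongr
            exact min_le_right _ _
        _ = _ := by rw [← hmul]; ring
    have hδα' : 0 < δ ^ α := Real.rpow_pos_of_pos hδ0 _
    refine h1.trans ?_
    rcases le_total ρ 1 with h' | h'
    · have h2 : ρ ≤ ρ ^ α := by
        simpa using Real.rpow_le_rpow_of_exponent_ge hρ h' hα
      have h3 : δ ^ α ≤ ρ ^ α := Real.rpow_le_rpow hδ0.le h hα0.le
      calc S.card * δ ^ α / 8 ≤ (M * (2 * ρ + δ) + 1) * δ ^ α / 8 := by gcongr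
        _ = ((δ ^ α * M) * (2 * ρ + δ) + δ ^ α) / 8 := by ring
        _ ≤ _ := by rw [hδM]; linarith
    · have h2 : 1 ≤ ρ ^ α := Real.one_le_rpow h' hα0.le
      calc S.card * δ ^ α / 8 ≤ M * δ ^ α / 8 := by gcongr
        _ = (δ ^ α * M) / 8 := by ring
        _ ≤ _ := by rw [hδM]; linarith

lemma ae_gridMeasure {α δ : ℝ} {M : ℕ} {p : ℝ → Prop}
    (h : ∀ j < M, ∀ x ∈ Set.Ico ((j : ℝ) / M) (j / M + δ), p x) :
    ∀ᵐ x ∂gridMeasure α δ M, p x := by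
  rw [ae_iff, gridMeasure, Measure.finsetSum_apply]
  refine Finset.sum_eq_zero fun j hj => ?_
  rw [Measure.smul_apply, smul_eq_mul]
  have : volume.restrict (Set.Ico ((j : ℝ) / M) (j / M + δ)) {x | ¬p x} = 0 :=
    ae_iff.1 ((ae_restrict_iff' measurableSet_Ico).2
      (Eventually.of_forall (h j (Finset.mem_range.1 hj))))
  rw [this, mul_zero]

lemma gridMeasure_univ {α δ : ℝ} {M : ℕ} (hδ0 : 0 < δ) (hδM : δ ^ α * M = 1) :
    gridMeasure α δ M Set.univ = ENNReal.ofReal (1 / 8) := by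
  rw [gridMeasure, Measure.finsetSum_apply]
  simp only [Measure.smul_apply, Measure.restrict_apply_univ, Real.volume_Ico, smul_eq_mul,
    add_sub_cancel_left, Finset.sum_const, Finset.card_range, nsmul_eq_mul]
  rw [← ENNReal.ofReal_mul (by positivity), ← ENNReal.ofReal_natCast,
    ← ENNReal.ofReal_mul (Nat.cast_nonneg _)]
  congr 1
  have hmul : δ ^ (α - 1) * δ = δ ^ α := by
    rw [← Real.rpow_add_one hδ0.ne']; congr 1; ring
  calc (M : ℝ) * (δ ^ (α - 1) / 8 * δ) = (δ ^ (α - 1) * δ) * M / 8 := by ring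
    _ = _ := by rw [hmul, hδM]

/-- A finitely supported sequence with `M` terms bounded by `D⁻²` lies in `ℓ^{r,∞}` as soon as
`M ≤ D ^ (2 r)`. -/
lemma memLorentz_of_finite {r D : ℝ} (hr : 0 < r) (hD : 0 < D) {M : ℕ} {t : ℕ → ℝ}
    (hsupp : ∀ k, M ≤ k → t k = 0) (hbd : ∀ k, |t k| ≤ 1 / D ^ 2) (hM : (M : ℝ) ≤ D ^ (2 * r)) :
    MemLorentz r t 1 := by
  intro δ hδ
  by_cases h : δ ≤ 1 / D ^ 2
  · have hsub : {k : ℕ | δ ≤ |t k|} ⊆ (Finset.range M : Set ℕ) := by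
      intro k hk
      rw [Finset.coe_range, Set.mem_Iio]
      by_contra! hle
      rw [Set.mem_ofPred_eq, hsupp k hle, abs_zero] at hk
      linarith
    have hcard : ({k : ℕ | δ ≤ |t k|}.encard : ℝ≥0∞) ≤ ENNReal.ofReal M := by
      have := Set.encard_le_encard hsub
      rw [Set.encard_coe_eq_coe_finsetCard, Finset.card_range] at this
      rw [ENNReal.ofReal_natCast]
      exact_mod_cast this
    calc _ ≤ ENNReal.ofReal (δ ^ r) * ENNReal.ofReal M := by gcongr
      _ = ENNReal.ofReal (δ ^ r * M) := (ENNReal.ofReal_mul (by positivity)).symm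
      _ ≤ _ := by
        refine ENNReal.ofReal_le_ofReal ?_
        calc δ ^ r * M ≤ (1 / D ^ 2) ^ r * D ^ (2 * r) := by gcongr
          _ = 1 := by
            rw [Real.rpow_mul hD.le, Real.rpow_two, ← Real.mul_rpow (by positivity) (by positivity)]
            field_simp
            simp
  · have : {k : ℕ | δ ≤ |t k|} = ∅ := by
      rw [Set.eq_empty_iff_forall_notMem]
      intro k hk
      exact h (le_trans hk (hbd k))
    rw [this]; simp

/-- Failure of the maximal estimate below regularity `1 / 4`. -/
lemma exists_maximalIntegral_gt {α r : ℝ} (hα0 : 0 < α) (hα : α ≤ 1) (hr : 0 < r)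
    (hαr : α ≤ 2 * r) {s : ℝ} (hs : s < 1 / 4) {C : ℝ} (hC : 0 < C) :
    ∃ (f : SchwartzMap ℝ ℂ) (t : ℕ → ℝ) (μ : Measure ℝ),
      MemLorentz r t 1 ∧ Tendsto t atTop (nhds 0) ∧ IsAlphaDimensional1D α 1 μ ∧
      ENNReal.ofReal (C * sobolevNormSq1D s ⇑f) < maximalIntegral1D μ t ⇑f := by
  have hσ : 0 < 1 - 4 * max s 0 := by
    have : max s 0 < 1 / 4 := max_lt hs (by norm_num)
    linarith
  have htend : Tendsto (fun M : ℕ => ((M : ℝ) ^ (1 / α)) ^ (1 - 4 * max s 0)) atTop atTop :=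
    (tendsto_rpow_atTop hσ).comp
      ((tendsto_rpow_atTop (by positivity)).comp tendsto_natCast_atTop_atTop)
  obtain ⟨M, hMbig, hM1⟩ :=
    ((htend.eventually_gt_atTop (C * 32768)).and (eventually_ge_atTop 1)).exists
  have hM' : (1 : ℝ) ≤ M := by exact_mod_cast hM1
  have hM0 : (0 : ℝ) < M := by linarith
  set D : ℝ := (M : ℝ) ^ (1 / α) with hDdef
  have hD : 1 ≤ D := Real.one_le_rpow hM' (by positivity)
  have hD0 : 0 < D := by linarith
  have hDα : D ^ α = M := by
    rw [hDdef, ← Real.rpow_mul hM0.le, one_div_mul_cancel hα0.ne', Real.rpow_one]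
  have hδM : (1 / D) ^ α * M = 1 := by
    rw [Real.div_rpow zero_le_one hD0.le, Real.one_rpow, hDα, one_div_mul_cancel hM0.ne']
  have hMD : (M : ℝ) ≤ D := by
    rw [← hDα]
    simpa using Real.rpow_le_rpow_of_exponent_le hD hα
  obtain ⟨f, hf1, hf2⟩ := exists_wavePacket hD
  let t : ℕ → ℝ := fun k => if k < M then -((k : ℝ) / M) / (2 * D ^ 2) else 0
  have ht1 : ∀ k, |t k| ≤ 1 / (2 * D ^ 2) := by
    intro k
    by_cases hk : k < M
    · have hk' : (k : ℝ) / M ≤ 1 := by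
        rw [div_le_one hM0]; exact_mod_cast hk.le
      simp only [t, if_pos hk]
      rw [abs_div, abs_neg, abs_of_nonneg (by positivity : (0 : ℝ) ≤ k / M),
        abs_of_pos (by positivity)]
      gcongr
    · simp only [t, if_neg hk, abs_zero]
      positivity
  have ht0 : ∀ k, M ≤ k → t k = 0 := fun k hk => if_neg (by omega)
  refine ⟨f, t, gridMeasure α (1 / D) M, ?_, ?_, ?_, ?_⟩
  · refine memLorentz_of_finite hr hD0 ht0 (fun k => (ht1 k).trans ?_) ?_
    · gcongr
      nlinarith
    · rw [← hDα]
      exact Real.rpow_le_rpow_of_exponent_le hD hαr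
  · exact tendsto_const_nhds.congr' ((eventually_ge_atTop M).mono fun k hk => (ht0 k hk).symm)
  · exact isAlphaDimensional_gridMeasure hα0 hα hM1 (by positivity)
      (by rw [div_le_one hD0]; exact hD) hδM
  · have hball : ∀ᵐ x ∂gridMeasure α (1 / D) M, x ∈ Metric.ball (0 : ℝ) 1 := by
      refine ae_gridMeasure fun j hj x hx => ?_
      rw [Real.ball_eq_Ioo]
      have h1 : (0 : ℝ) ≤ j / M := by positivity
      have h2 : (j : ℝ) / M + 1 / D ≤ 1 := by
        have h3 : 1 / D ≤ 1 / M := by gcongr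
        have h4 : (j : ℝ) / M + 1 / M ≤ 1 := by
          rw [← add_div, div_le_one hM0]
          exact_mod_cast hj
        linarith
      exact ⟨by linarith [hx.1], by linarith [hx.2]⟩
    have hlow : ∀ᵐ x ∂gridMeasure α (1 / D) M, ENNReal.ofReal ((D / 64) ^ 2)
        ≤ ⨆ k : ℕ, ENNReal.ofReal (‖schrodingerEvolution1D f (t k) x‖ ^ 2) := by
      refine ae_gridMeasure fun j hj x hx => ?_
      refine le_iSup_of_le j (ENNReal.ofReal_le_ofReal ?_)
      have hxt : x + 2 * t j * D ^ 2 = x - j / M := by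
        simp only [t, if_pos hj]
        field_simp
        ring
      have := hf2 (t j) x (by
        rw [hxt, abs_of_nonneg (by linarith [hx.1])]; linarith [hx.2]) (ht1 j)
      gcongr
    have hint : ENNReal.ofReal ((D / 64) ^ 2) * ENNReal.ofReal (1 / 8)
        ≤ maximalIntegral1D (gridMeasure α (1 / D) M) t f := by
      rw [maximalIntegral1D, Measure.restrict_eq_self_of_ae_mem hball,
        ← gridMeasure_univ (α := α) (δ := 1 / D) (M := M) (by positivity) hδM, ← lintegral_const]
      exact lintegral_mono_ae hlow
    refine lt_of_lt_of_le ?_ hint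
    rw [← ENNReal.ofReal_mul (by positivity)]
    refine (ENNReal.ofReal_lt_ofReal_iff (by positivity)).2 ?_
    have hsplit : D = D ^ (1 - 4 * max s 0) * D ^ (4 * max s 0) := by
      rw [← Real.rpow_add hD0]; simp
    have hp : 0 < D ^ (4 * max s 0) := by positivity
    calc C * sobolevNormSq1D s f ≤ C * (D * D ^ (4 * max s 0)) := by
          gcongr
          exact hf1 s hs.le
      _ = D * (C * D ^ (4 * max s 0)) := by ring
      _ < D * (D / 32768) := by
          refine mul_lt_mul_of_pos_left ?_ hD0
          rw [lt_div_iff₀ (by norm_num)]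
          calc C * D ^ (4 * max s 0) * 32768 = (C * 32768) * D ^ (4 * max s 0) := by ring
            _ < D ^ (1 - 4 * max s 0) * D ^ (4 * max s 0) := mul_lt_mul_of_pos_right hMbig hp
            _ = D := hsplit.symm
      _ = _ := by ring

/-- in dimension one, for `1/2 ≤ α ≤ 1` and `α ≤ 2r`, the critical
exponent for the `α`-dimensional sequential Schrödinger maximal estimate is `1/4`. -/
theorem fractal_sequential_critical_exponent_1D
    (α r : ℝ) (hα0 : 1 / 2 ≤ α) (hα : α ≤ 1) (hr : 0 < r) (hαr : α ≤ 2 * r) :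
    ((∀ s : ℝ, 1 / 4 < s → ∃ C : ℝ, 0 < C ∧
      ∀ t : ℕ → ℝ, MemLorentz r t 1 →
      ∀ μ : Measure ℝ, IsAlphaDimensional1D α 1 μ →
      ∀ f : SchwartzMap ℝ ℂ,
        maximalIntegral1D μ t ⇑f ≤ ENNReal.ofReal (C * sobolevNormSq1D s ⇑f))
    ∧
    (∀ s : ℝ, s < 1 / 4 → ∀ C : ℝ, 0 < C →
      ∃ (f : SchwartzMap ℝ ℂ) (t : ℕ → ℝ) (μ : Measure ℝ),
        MemLorentz r t 1 ∧ Tendsto t atTop (nhds 0) ∧ IsAlphaDimensional1D α 1 μ ∧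
        ENNReal.ofReal (C * sobolevNormSq1D s ⇑f) < maximalIntegral1D μ t ⇑f)) := by
  refine ⟨fun s hs => ?_, fun s hs C hC =>
    exists_maximalIntegral_gt (by linarith) hα hr hαr hs hC⟩
  obtain ⟨C, hC, h⟩ := exists_maximalIntegral_le hα0 hs
  exact ⟨C, hC, fun t _ μ hμ f => h t μ hμ f⟩
end
end
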